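/- arXiv:1908.09793 — 6 statements merged into one kernel-verified Lean document; each statement's English description precedes it below -/
import Mathlib

section
/- Let f(x) = x^5 + a x + b ∈ ℤ[x] be irreducible with a odd and b even, and let θ be a root. Then 2 does not divide the index [O_{ℚ(θ)} : ℤ[θ]] if and only if a + b ≡ 1 (mod 4). -/
open Polynomial NumberField

/-- The index of the order `ℤ[θ]` in the ring of integers of `K`. -/
noncomputable def indexZTheta {K : Type*} [Field K] [NumberField K]
    (θ : NumberField.RingOfIntegers K) : ℕ :=
  (Algebra.adjoin ℤ ({θ} : Set (NumberField.RingOfIntegers K))).toSubring.toAddSubgroup.index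

section Helpers

variable {K : Type*} [Field K] [NumberField K]

theorem aux_minpoly (a b : ℤ)
    (hirr : Irreducible ((X ^ 5 + C a * X + C b : ℤ[X]).map (Int.castRingHom ℚ)))
    (t : K) (h : t ^ 5 + a * t + b = 0) :
    (X ^ 5 + C a * X + C b : ℤ[X]).map (Int.castRingHom ℚ) = minpoly ℚ t := by
  refine minpoly.eq_of_irreducible_of_monic hirr ?_ ?_
  · simpa using h
  · apply Monic.map
    monicity!

theorem aux_natDegree (a b : ℤ) : (X ^ 5 + C a * X + C b : ℤ[X]).natDegree = 5 := by
  compute_degree!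

theorem aux_trace (a b : ℤ)
    (hirr : Irreducible ((X ^ 5 + C a * X + C b : ℤ[X]).map (Int.castRingHom ℚ)))
    (t : K) (h : t ^ 5 + a * t + b = 0) (hgen : Algebra.adjoin ℚ ({t} : Set K) = ⊤) :
    Algebra.trace ℚ K (t ^ 4) = -4 * a ∧ Module.finrank ℚ K = 5 := by
  have hmin := aux_minpoly a b hirr t h
  have hint : IsIntegral ℚ t := Algebra.IsIntegral.isIntegral t
  let B := PowerBasis.ofAdjoinEqTop hint hgen
  have hBg : B.gen = t := by simp [B]
  have hBd : B.dim = 5 := by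
    rw [← B.natDegree_minpoly, hBg, ← hmin, Polynomial.natDegree_map_eq_of_injective
      (RingHom.injective_int _), aux_natDegree]
  let v : Module.Basis (Fin 5) ℚ K := B.basis.reindex (finCongr hBd)
  have hv : ∀ i : Fin 5, v i = t ^ (i : ℕ) := by
    intro i
    simp [v, hBg]
  refine ⟨?_, by simpa using Module.finrank_eq_card_basis v⟩
  rw [Algebra.trace_eq_matrix_trace v, Matrix.trace, Fin.sum_univ_five]
  simp only [Matrix.diag_apply, Algebra.leftMulMatrix_eq_repr_mul]
  have h0 : t ^ 4 * v 0 = v 4 := by simp [hv]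
  have h1 : t ^ 4 * v 1 = (-a : ℚ) • v 1 + (-b : ℚ) • v 0 := by
    simp [hv, Algebra.smul_def]; linear_combination h
  have h2 : t ^ 4 * v 2 = (-a : ℚ) • v 2 + (-b : ℚ) • v 1 := by
    simp [hv, Algebra.smul_def]; linear_combination t * h
  have h3 : t ^ 4 * v 3 = (-a : ℚ) • v 3 + (-b : ℚ) • v 2 := by
    simp [hv, Algebra.smul_def]; linear_combination t ^ 2 * h
  have h4 : t ^ 4 * v 4 = (-a : ℚ) • v 4 + (-b : ℚ) • v 3 := by
    simp [hv, Algebra.smul_def]; linear_combination t ^ 3 * h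
  rw [h0, h1, h2, h3, h4]
  simp
  ring

/-- The `2`-part criterion for the index. -/
theorem aux_index (θ : 𝓞 K) (hgen : Algebra.adjoin ℚ ({(θ : K)} : Set K) = ⊤) :
    ¬ 2 ∣ indexZTheta θ ↔ ∀ α : 𝓞 K, 2 * α ∈ Algebra.adjoin ℤ ({θ} : Set (𝓞 K)) →
      α ∈ Algebra.adjoin ℤ ({θ} : Set (𝓞 K)) := by
  set A := Algebra.adjoin ℤ ({θ} : Set (𝓞 K)) with hA
  set G := A.toSubring.toAddSubgroup with hG
  have hmem : ∀ x, x ∈ G ↔ x ∈ A := fun x => Iff.rfl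
  have hidx : indexZTheta θ = Nat.card (𝓞 K ⧸ G) := rfl
  rw [hidx]
  constructor
  · intro h α h2
    by_contra hα
    apply h
    have : addOrderOf (QuotientAddGroup.mk α : 𝓞 K ⧸ G) = 2 := by
      have : Fact (Nat.Prime 2) := ⟨Nat.prime_two⟩
      apply addOrderOf_eq_prime
      · rw [← QuotientAddGroup.mk_nsmul, QuotientAddGroup.eq_zero_iff, hmem]
        simpa [two_mul, two_nsmul] using h2
      · rwa [Ne, QuotientAddGroup.eq_zero_iff, hmem]
    rw [← this]
    exact addOrderOf_dvd_natCard _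
  · intro h h2
    have hfin : Finite (𝓞 K ⧸ G) := by
      have htor : ∀ x : K, ∃ n : ℤ, n ≠ 0 ∧ ∃ z ∈ A, (n : K) * x = algebraMap (𝓞 K) K z := by
        intro x
        have hx : x ∈ Algebra.adjoin ℚ ({(θ : K)} : Set K) := by rw [hgen]; trivial
        induction hx using Algebra.adjoin_induction with
        | mem x hx =>
          rw [Set.mem_singleton_iff] at hx
          subst hx
          exact ⟨1, one_ne_zero, θ, Algebra.subset_adjoin rfl, by simp⟩
        | algebraMap r =>
          refine ⟨r.den, by exact_mod_cast r.den_ne_zero, (r.num : 𝓞 K), ?_, ?_⟩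
          · exact A.intCast_mem _
          · have := Rat.den_mul_eq_num r
            have h' := congrArg (Rat.cast : ℚ → K) this
            rw [Rat.cast_mul] at h'
            simpa only [Rat.cast_natCast, Rat.cast_intCast, Int.cast_natCast, map_intCast,
              eq_ratCast] using h'
        | add x y _ _ hx hy =>
          obtain ⟨n, hn, z, hz, e⟩ := hx
          obtain ⟨m, hm, w, hw, e'⟩ := hy
          refine ⟨n * m, mul_ne_zero hn hm, m * z + n * w, ?_, ?_⟩
          · exact A.add_mem (A.mul_mem (A.intCast_mem _) hz) (A.mul_mem (A.intCast_mem _) hw)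
          · simp only [Int.cast_mul, map_add, map_mul, map_intCast]; linear_combination m * e + n * e'
        | mul x y _ _ hx hy =>
          obtain ⟨n, hn, z, hz, e⟩ := hx
          obtain ⟨m, hm, w, hw, e'⟩ := hy
          refine ⟨n * m, mul_ne_zero hn hm, z * w, A.mul_mem hz hw, ?_⟩
          rw [Int.cast_mul, map_mul, ← e, ← e']; ring
      have : Module.Finite ℤ (𝓞 K ⧸ G) :=
        Module.Finite.of_surjective (QuotientAddGroup.mk' G).toIntLinearMap
          (QuotientAddGroup.mk'_surjective G)
      apply Module.finite_of_fg_torsion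
      intro x
      obtain ⟨α, rfl⟩ := QuotientAddGroup.mk_surjective x
      obtain ⟨n, hn, z, hz, e⟩ := htor (α : K)
      refine ⟨⟨n, mem_nonZeroDivisors_of_ne_zero hn⟩, ?_⟩
      change n • (QuotientAddGroup.mk α : 𝓞 K ⧸ G) = 0
      rw [← QuotientAddGroup.mk_zsmul, QuotientAddGroup.eq_zero_iff, hmem]
      have : n • α = z := by
        apply RingOfIntegers.ext
        change algebraMap (𝓞 K) K (n • α) = algebraMap (𝓞 K) K z
        rw [← e, map_zsmul, zsmul_eq_mul]
      rwa [this]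
    have : Fact (Nat.Prime 2) := ⟨Nat.prime_two⟩
    obtain ⟨x, hx⟩ := exists_prime_addOrderOf_dvd_card' 2 h2
    obtain ⟨α, rfl⟩ := QuotientAddGroup.mk_surjective x
    have h0 := addOrderOf_nsmul_eq_zero (QuotientAddGroup.mk α : 𝓞 K ⧸ G)
    rw [hx, ← QuotientAddGroup.mk_nsmul, QuotientAddGroup.eq_zero_iff, hmem] at h0
    have h1 : (QuotientAddGroup.mk α : 𝓞 K ⧸ G) = 0 := by
      rw [QuotientAddGroup.eq_zero_iff, hmem]
      apply h
      simpa [two_mul, two_nsmul] using h0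
    rw [h1] at hx
    simp at hx

/-- If `a + b ≡ 3 (mod 4)` there is an integral element outside `ℤ[θ]`. -/
theorem aux_bad (a b c d : ℤ) (hc : 1 + a + b = 4 * c) (hd : 5 + a = 2 * d)
    (hirr : Irreducible ((X ^ 5 + C a * X + C b : ℤ[X]).map (Int.castRingHom ℚ)))
    (θ : 𝓞 K) (h : θ ^ 5 + a * θ + b = 0) :
    ∃ β : 𝓞 K, 2 * β ∈ Algebra.adjoin ℤ ({θ} : Set (𝓞 K)) ∧
      β ∉ Algebra.adjoin ℤ ({θ} : Set (𝓞 K)) := by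
  have hK : (θ : K) ^ 5 + a * θ + b = 0 := by
    have := congrArg (algebraMap (𝓞 K) K) h
    simpa using this
  have hcK : (1 + a + b : K) = 4 * c := by exact_mod_cast congrArg (Int.cast : ℤ → K) hc
  have hdK : (5 + a : K) = 2 * d := by exact_mod_cast congrArg (Int.cast : ℤ → K) hd
  set t : K := algebraMap (𝓞 K) K θ with ht
  let β : K := (t ^ 4 + t ^ 3 + t ^ 2 + t + 1 + a) / 2
  have hβ : 2 * β = t ^ 4 + t ^ 3 + t ^ 2 + t + 1 + a := by simp only [β]; ring
  have hyβ : (t - 1) * β = -2 * c := by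
    have : (2 : K) ≠ 0 := two_ne_zero
    apply mul_left_cancel₀ this
    linear_combination (t - 1) * hβ + hK - hcK
  have h2β : 2 * β = (t-1)^4 + 5*(t-1)^3 + 10*(t-1)^2 + 10*(t-1) + 2*d := by
    rw [hβ, ← hdK]; ring
  have hP : β^5 - d*β^4 + 10*c*β^3 - 20*c^2*β^2 + 20*c^3*β - 8*c^4 = 0 := by
    generalize t - 1 = y at *
    have e1 : β^4 * y^4 = 16 * c^4 := by rw [← mul_pow, mul_comm, hyβ]; ring
    have e2 : β^4 * y^3 = -8 * c^3 * β := by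
      linear_combination β * ((y*β)^2 + (y*β)*(-2*c) + (-2*c)^2) * hyβ
    have e3 : β^4 * y^2 = 4 * c^2 * β^2 := by
      linear_combination β^2 * ((y*β) + (-2*c)) * hyβ
    have e4 : β^4 * y = -2 * c * β^3 := by
      linear_combination β^3 * hyβ
    have : (2 : K) ≠ 0 := two_ne_zero
    apply mul_left_cancel₀ this
    linear_combination β^4 * h2β + e1 + 5 * e2 + 10 * e3 + 10 * e4
  have hint : IsIntegral ℤ β := by
    refine ⟨X^5 - C d * X^4 + C (10*c) * X^3 - C (20*c^2) * X^2 + C (20*c^3) * X - C (8*c^4),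
      by monicity!, ?_⟩
    rw [← hP]
    simp only [eval₂_add, eval₂_sub, eval₂_mul, eval₂_pow, eval₂_X, eval₂_C]
    simp only [algebraMap_int_eq, eq_intCast]
    push_cast
    ring
  obtain ⟨γ, hγ⟩ : ∃ γ : 𝓞 K, algebraMap (𝓞 K) K γ = β := ⟨⟨β, hint⟩, rfl⟩
  have h2γ : 2 * γ = θ ^ 4 + θ ^ 3 + θ ^ 2 + θ + 1 + a := by
    apply RingOfIntegers.ext
    change algebraMap (𝓞 K) K _ = algebraMap (𝓞 K) K _
    rw [map_mul, hγ]
    simp only [map_add, map_pow, map_one, map_intCast, map_ofNat]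
    exact hβ
  refine ⟨γ, ?_, ?_⟩
  · rw [h2γ]
    have hθ : θ ∈ Algebra.adjoin ℤ ({θ} : Set (𝓞 K)) := Algebra.subset_adjoin rfl
    exact add_mem (add_mem (add_mem (add_mem (add_mem (pow_mem hθ _) (pow_mem hθ _))
      (pow_mem hθ _)) hθ) (one_mem _)) (Subalgebra.intCast_mem _ a)
  · intro hmem
    rw [Algebra.adjoin_singleton_eq_range_aeval] at hmem
    obtain ⟨p, hp⟩ := hmem
    let Q : ℤ[X] := X ^ 4 + X ^ 3 + X ^ 2 + X + C (1 + a)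
    have hz : aeval t (Q - C 2 * p) = 0 := by
      have hp' : aeval t p = algebraMap (𝓞 K) K γ := by
        rw [← hp]
        exact aeval_algebraMap_apply K θ p
      simp only [map_sub, map_mul, hp', hγ, Q, map_add, map_pow, aeval_X, aeval_C]
      simp only [algebraMap_int_eq, eq_intCast]
      push_cast
      linear_combination -hβ
    have hdvd : (X ^ 5 + C a * X + C b : ℤ[X]) ∣ Q - C 2 * p := by
      rw [← Polynomial.map_dvd_map (Int.castRingHom ℚ) (RingHom.injective_int _)
        (by monicity!), aux_minpoly a b hirr t hK]
      apply minpoly.dvd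
      rw [← algebraMap_int_eq, aeval_map_algebraMap]
      exact hz
    have hdvd2 := Polynomial.map_dvd (Int.castRingHom (ZMod 2)) hdvd
    have e2 : (Q - C 2 * p).map (Int.castRingHom (ZMod 2)) =
        X ^ 4 + X ^ 3 + X ^ 2 + X + C (1 + (a : ZMod 2)) := by
      have : (2 : (ZMod 2)[X]) = 0 := CharTwo.two_eq_zero
      simp [Q, this]
    rw [e2] at hdvd2
    have hm : (X ^ 4 + X ^ 3 + X ^ 2 + X + C (1 + (a : ZMod 2)) : (ZMod 2)[X]).Monic := by
      monicity!
    have hd4 : (X ^ 4 + X ^ 3 + X ^ 2 + X + C (1 + (a : ZMod 2)) : (ZMod 2)[X]).natDegree = 4 := by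
      compute_degree!
    have hd5 : ((X ^ 5 + C a * X + C b : ℤ[X]).map (Int.castRingHom (ZMod 2))).natDegree = 5 := by
      rw [Monic.natDegree_map (by monicity!), aux_natDegree]
    have := Polynomial.natDegree_le_of_dvd hdvd2 hm.ne_zero
    omega

theorem aux_span (a b : ℤ) (θ : 𝓞 K) (h : θ ^ 5 + a * θ + b = 0) (z : 𝓞 K)
    (hz : z ∈ Algebra.adjoin ℤ ({θ} : Set (𝓞 K))) :
    ∃ d0 d1 d2 d3 d4 : ℤ, z = d0 + d1 * (θ - 1) + d2 * (θ - 1) ^ 2 + d3 * (θ - 1) ^ 3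
      + d4 * (θ - 1) ^ 4 := by
  rw [Algebra.adjoin_singleton_eq_range_aeval] at hz
  obtain ⟨p, hp⟩ := hz
  let g : ℤ[X] := X ^ 5 + C 5 * X ^ 4 + C 10 * X ^ 3 + C 10 * X ^ 2 + C (5 + a) * X + C (1 + a + b)
  have hg : g.Monic := by simp only [g]; monicity!
  have hgd : g.natDegree = 5 := by simp only [g]; compute_degree!
  have hg0 : aeval (θ - 1) g = 0 := by
    simp only [g, aeval_add, aeval_mul, aeval_X_pow, aeval_X, aeval_C]
    simp only [algebraMap_int_eq, eq_intCast]
    push_cast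
    linear_combination h
  have e1 : aeval (θ - 1) (p.comp (X + 1)) = z := by
    rw [aeval_comp, ← hp]; simp
  have e2 := aeval_modByMonic_eq_self_of_root (p := p.comp (X + 1)) hg0
  have hdeg : (p.comp (X + 1) %ₘ g).natDegree < 5 := by
    rw [← hgd]
    apply natDegree_modByMonic_lt _ hg
    intro h1
    rw [h1] at hgd
    simp at hgd
  rw [as_sum_range' _ 5 hdeg] at e2
  rw [e1] at e2
  generalize p.comp (X + 1) %ₘ g = r at *
  refine ⟨r.coeff 0, r.coeff 1, r.coeff 2, r.coeff 3, r.coeff 4, ?_⟩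
  rw [← e2]
  simp [Finset.sum_range_succ, aeval_monomial]

theorem aux_good (a b e d : ℤ) (ha : Odd a) (hb : Even b) (he : Odd e)
    (hc : 1 + a + b = 2 * e) (hd : 5 + a = 2 * d)
    (θ : 𝓞 K) (h : θ ^ 5 + a * θ + b = 0)
    (htr : Algebra.trace ℤ (𝓞 K) (θ ^ 4) = -4 * a) (hfr : Module.finrank ℤ (𝓞 K) = 5)
    (α : 𝓞 K) (hα : 2 * α ∈ Algebra.adjoin ℤ ({θ} : Set (𝓞 K))) :
    α ∈ Algebra.adjoin ℤ ({θ} : Set (𝓞 K)) := by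
  obtain ⟨d0, d1, d2, d3, d4, hz⟩ := aux_span a b θ h _ hα
  have hcK : (1 + a + b : 𝓞 K) = 2 * e := by exact_mod_cast congrArg (Int.cast : ℤ → 𝓞 K) hc
  have hdK : (5 + a : 𝓞 K) = 2 * d := by exact_mod_cast congrArg (Int.cast : ℤ → 𝓞 K) hd
  have h20 : (2 : 𝓞 K) ≠ 0 := two_ne_zero
  have htrm : ∀ (n : ℤ) (x : 𝓞 K), Algebra.trace ℤ (𝓞 K) (n * x) = n * Algebra.trace ℤ (𝓞 K) x := by
    intro n x
    rw [← zsmul_eq_mul, map_zsmul, smul_eq_mul]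
  have htrc : ∀ n : ℤ, Algebra.trace ℤ (𝓞 K) (n : 𝓞 K) = 5 * n := by
    intro n
    have := Algebra.trace_algebraMap (R := ℤ) (S := 𝓞 K) n
    rw [hfr] at this
    simpa using this
  -- `θ` is not divisible by `2`
  have hθ2 : ∀ s : 𝓞 K, θ ≠ 2 * s := by
    intro s hs
    have : θ ^ 4 = ((16 : ℤ) : 𝓞 K) * s ^ 4 := by rw [hs]; push_cast; ring
    rw [this, htrm] at htr
    obtain ⟨k, rfl⟩ := ha
    omega
  -- `(θ - 1) ^ 4` is not divisible by `2`
  have hy2 : ∀ s : 𝓞 K, (θ - 1) ^ 4 ≠ 2 * s := by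
    intro s hs
    have : θ ^ 4 = ((2 : ℤ) : 𝓞 K) * (s + 2 * θ ^ 3 - 3 * θ ^ 2 + 2 * θ) + ((-1 : ℤ) : 𝓞 K) := by
      push_cast; linear_combination hs
    rw [this, map_add, htrm, htrc] at htr
    omega
  obtain ⟨y, hy⟩ : ∃ y, y = θ - 1 := ⟨_, rfl⟩
  have hθy : θ = y + 1 := by rw [hy]; ring
  rw [← hy] at hz hy2
  have hg : y ^ 4 * (y + 5) = -2 * (e + y * (d + 5 * y + 5 * y ^ 2)) := by
    rw [hθy] at h
    linear_combination h - hcK - y * hdK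
  -- `θ - 1` is not a unit modulo `2`
  have hA : ∀ μ ν : 𝓞 K, y * μ ≠ 1 + 2 * ν := by
    intro μ ν hμ
    have e1 : (1 + 2 * ν) ^ 4 * (y + 5) = 2 * (-(e + y * (d + 5 * y + 5 * y ^ 2)) * μ ^ 4) := by
      rw [← hμ]; linear_combination μ ^ 4 * hg
    apply hθ2 (-(e + y * (d + 5 * y + 5 * y ^ 2)) * μ ^ 4 - 2
      - (y + 5) * (4 * ν + 12 * ν ^ 2 + 16 * ν ^ 3 + 8 * ν ^ 4))
    rw [hθy]
    linear_combination e1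
  have hodd : ∀ (n : ℤ) (μ ν : 𝓞 K), Odd n → (n : 𝓞 K) = y * μ + 2 * ν → False := by
    rintro n μ ν ⟨k, rfl⟩ hn
    apply hA μ (k - ν)
    push_cast at hn
    linear_combination -hn
  have he0 : Even d0 := by
    by_contra hn
    rw [Int.not_even_iff_odd] at hn
    apply hodd d0 (-(d1 + d2 * y + d3 * y ^ 2 + d4 * y ^ 3)) α hn
    linear_combination -hz
  obtain ⟨c0, rfl⟩ := he0
  push_cast at hz
  have he1 : Even d1 := by
    by_contra hn
    rw [Int.not_even_iff_odd] at hn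
    apply hodd (e * d1) (-((α - c0) * y ^ 2 * (y + 5) + (d + 5 * y + 5 * y ^ 2) * (d1 + d2 * y + d3 * y ^ 2 + d4 * y ^ 3) + e * (d2 + d3 * y + d4 * y ^ 2))) 0 (he.mul hn)
    apply mul_left_cancel₀ h20
    push_cast
    linear_combination y ^ 3 * (y + 5) * hz + (d1 + d2 * y + d3 * y ^ 2 + d4 * y ^ 3) * hg
  obtain ⟨c1, rfl⟩ := he1
  push_cast at hz
  have he2 : Even d2 := by
    by_contra hn
    rw [Int.not_even_iff_odd] at hn
    apply hodd (e * d2) (-((α - c0 - c1 * y) * y * (y + 5) + (d + 5 * y + 5 * y ^ 2) * (d2 + d3 * y + d4 * y ^ 2) + e * (d3 + d4 * y))) 0 (he.mul hn)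
    apply mul_left_cancel₀ h20
    push_cast
    linear_combination y ^ 2 * (y + 5) * hz + (d2 + d3 * y + d4 * y ^ 2) * hg
  obtain ⟨c2, rfl⟩ := he2
  push_cast at hz
  have he3 : Even d3 := by
    by_contra hn
    rw [Int.not_even_iff_odd] at hn
    apply hodd (e * d3) (-((α - c0 - c1 * y - c2 * y ^ 2) * (y + 5) + (d + 5 * y + 5 * y ^ 2) * (d3 + d4 * y) + e * d4)) 0 (he.mul hn)
    apply mul_left_cancel₀ h20
    push_cast
    linear_combination y * (y + 5) * hz + (d3 + d4 * y) * hg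
  obtain ⟨c3, rfl⟩ := he3
  push_cast at hz
  have he4 : Even d4 := by
    by_contra hn
    rw [Int.not_even_iff_odd] at hn
    obtain ⟨k, rfl⟩ := hn
    apply hy2 (α - c0 - c1 * y - c2 * y ^ 2 - c3 * y ^ 3 - k * y ^ 4)
    push_cast at hz
    linear_combination -hz
  obtain ⟨c4, rfl⟩ := he4
  push_cast at hz
  have hfin : α = c0 + c1 * y + c2 * y ^ 2 + c3 * y ^ 3 + c4 * y ^ 4 := by
    apply mul_left_cancel₀ h20
    linear_combination hz
  have hyA : y ∈ Algebra.adjoin ℤ ({θ} : Set (𝓞 K)) := by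
    rw [hy]
    exact sub_mem (Algebra.subset_adjoin rfl) (one_mem _)
  rw [hfin]
  have hi : ∀ n : ℤ, (n : 𝓞 K) ∈ Algebra.adjoin ℤ ({θ} : Set (𝓞 K)) :=
    fun n => Subalgebra.intCast_mem _ n
  exact add_mem (add_mem (add_mem (add_mem (hi _) (mul_mem (hi _) hyA))
    (mul_mem (hi _) (pow_mem hyA _))) (mul_mem (hi _) (pow_mem hyA _)))
    (mul_mem (hi _) (pow_mem hyA _))

end Helpers

theorem stmt6 (a b : ℤ) (ha : Odd a) (hb : Even b)
    (f : ℤ[X]) (hf : f = X ^ 5 + C a * X + C b)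
    (hirr : Irreducible (f.map (Int.castRingHom ℚ)))
    (K : Type*) [Field K] [NumberField K] (θ : NumberField.RingOfIntegers K)
    (hroot : Polynomial.aeval θ f = 0)
    (hgen : Algebra.adjoin ℚ ({(θ : K)} : Set K) = ⊤) :
    ¬ 2 ∣ indexZTheta θ ↔ a + b ≡ 1 [ZMOD 4] := by
  subst hf
  have h : θ ^ 5 + a * θ + b = 0 := by simpa using hroot
  have hK : (θ : K) ^ 5 + a * θ + b = 0 := by
    have := congrArg (algebraMap (𝓞 K) K) h
    simpa using this
  obtain ⟨d, hd⟩ : ∃ d, 5 + a = 2 * d := by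
    obtain ⟨k, rfl⟩ := ha
    exact ⟨k + 3, by ring⟩
  rw [aux_index θ hgen]
  constructor
  · intro hall
    by_contra hmod
    obtain ⟨c, hc⟩ : ∃ c, 1 + a + b = 4 * c := by
      obtain ⟨k, rfl⟩ := ha
      obtain ⟨l, rfl⟩ := hb
      refine ⟨(1 + (2 * k + 1) + (l + l)) / 4, ?_⟩
      unfold Int.ModEq at hmod
      omega
    obtain ⟨β, h1, h2⟩ := aux_bad a b c d hc hd hirr θ h
    exact h2 (hall β h1)
  · intro hmod α hα
    obtain ⟨e, hc, he⟩ : ∃ e, 1 + a + b = 2 * e ∧ Odd e := by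
      unfold Int.ModEq at hmod
      refine ⟨(1 + a + b) / 2, by omega, ?_⟩
      rw [Int.odd_iff]
      omega
    obtain ⟨ht, hfr⟩ := aux_trace a b hirr (θ : K) hK hgen
    refine aux_good a b e d ha hb he hc hd θ h ?_ ?_ α hα
    · have := Algebra.coe_trace_int (K := K) (θ ^ 4)
      have := this.trans (congrArg _ (map_pow (algebraMap (𝓞 K) K) θ 4))
      rw [ht] at this
      exact_mod_cast this
    · rw [RingOfIntegers.rank, hfr]
end

section
/- Let f(x) = x^5 + a x + b ∈ ℤ[x] be irreducible with θ a root, and suppose (2^8 a^5 + 5^5 b^4)/gcd(2^8 a^5, 5^5 b^4) is square-free. Then ℤ[θ] is the full ring of integers of ℚ(θ) if and only if for each prime p dividing gcd(2a, 5b) one of the following holds: (1) p | a, p | b, and p^2 ∤ b; (2) p = 2, 2 ∤ a, and a + b ≡ 1 (mod 4); (3) p = 5, 5 ∤ b, and b is not congruent to 1+a, 7+2a, 18+3a, or 24+4a modulo 25. -/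
open Polynomial NumberField

theorem nil_aux {O : Type*} [CommRing O] (θ α : O) (f u v : ℤ[X])
    (hdiv : ∀ g : ℤ[X], aeval θ g = 0 → f ∣ g) (hα : IsIntegral ℤ α)
    (h : aeval θ u * α = aeval θ v) {B : Type*} [CommRing B] (ψ : ℤ[X] →+* B)
    (hf : ψ f = 0) (hu : ψ u = 0) : ∃ n : ℕ, ψ v ^ n = 0 := by
  obtain ⟨q, hq, hq0⟩ := hα
  refine ⟨q.natDegree, ?_⟩
  nontriviality B
  have h1 : aeval θ ((scaleRoots (q.map C) u).eval v) = 0 := by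
    have e1 : aeval θ ((scaleRoots (q.map C) u).eval v)
        = (scaleRoots (q.map C) u).eval₂ (aeval θ : ℤ[X] →ₐ[ℤ] O).toRingHom (aeval θ v) := by
      have := hom_eval₂ (scaleRoots (q.map C) u) (RingHom.id _) (aeval θ : ℤ[X] →ₐ[ℤ] O).toRingHom v
      rwa [eval₂_id, RingHom.comp_id] at this
    rw [e1, ← h]
    apply scaleRoots_eval₂_eq_zero (f := (aeval θ : ℤ[X] →ₐ[ℤ] O).toRingHom)
    rw [eval₂_map]
    have e2 : (aeval θ : ℤ[X] →ₐ[ℤ] O).toRingHom.comp C = algebraMap ℤ O := RingHom.ext_int _ _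
    rw [e2]; exact hq0
  obtain ⟨w, hw⟩ := hdiv _ h1
  have h2 : ψ ((scaleRoots (q.map C) u).eval v) = 0 := by rw [hw, map_mul, hf, zero_mul]
  rw [← eval₂_id, hom_eval₂, RingHom.comp_id, eval₂_eq_eval_map] at h2
  rw [map_scaleRoots _ _ _ (by simp [(hq.map C).leadingCoeff]), hu, scaleRoots_zero] at h2
  rw [((hq.map C).map ψ).leadingCoeff, (hq.map C).natDegree_map, hq.natDegree_map] at h2
  simpa using h2

theorem ded_core {O : Type*} [CommRing O] [IsDomain O] [CharZero O] (θ : O) (f : ℤ[X])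
    (hint : ∀ x : O, IsIntegral ℤ x)
    (hdiv : ∀ g : ℤ[X], aeval θ g = 0 → f ∣ g) (hroot : aeval θ f = 0)
    (p : ℕ) [Fact p.Prime] (y : O) (hy : ∀ g : ℤ[X], aeval θ g ≠ y) (g : ℤ[X])
    (hg : aeval θ g = p * y) :
    ∃ φ : (ZMod p)[X], φ.Monic ∧ Irreducible φ ∧ φ * φ ∣ f.map (Int.castRingHom (ZMod p)) ∧
      ∀ Φ H F : ℤ[X], Φ.map (Int.castRingHom (ZMod p)) = φ →
        f = Φ * H + C (p : ℤ) * F → φ ∣ F.map (Int.castRingHom (ZMod p)) := by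
  have hp0 : (p : O) ≠ 0 := by exact_mod_cast (Fact.out : p.Prime).ne_zero
  set π : ℤ[X] →+* (ZMod p)[X] := mapRingHom (Int.castRingHom (ZMod p)) with hπ
  have hsurj : Function.Surjective π :=
    map_surjective _ (ZMod.ringHom_surjective _)
  have hker : ∀ h : ℤ[X], π h = 0 → ∃ w, h = C (p : ℤ) * w := by
    intro h hh
    have : C (p : ℤ) ∣ h := by
      rw [C_dvd_iff_dvd_coeff]
      intro i
      have := congrArg (fun q => q.coeff i) hh
      simp only [hπ, coe_mapRingHom, coeff_map, coeff_zero, eq_intCast] at this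
      exact (ZMod.intCast_zmod_eq_zero_iff_dvd _ _).1 this
    exact this
  have hπp : π (C (p : ℤ)) = 0 := by simp [hπ]
  let J : Ideal ℤ[X] := (Ideal.span {(p : O)}).comap (aeval θ : ℤ[X] →ₐ[ℤ] O).toRingHom
  have memJ : ∀ h, h ∈ J ↔ ∃ α, aeval θ h = p * α := by
    intro h
    simp only [J, Ideal.mem_comap, Ideal.mem_span_singleton]
    rfl
  have memI : ∀ h, π h ∈ J.map π → h ∈ J := by
    intro h hh
    obtain ⟨s, hs, hsh⟩ := Ideal.mem_image_of_mem_map_of_surjective π hsurj hh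
    obtain ⟨w, hw⟩ := hker (h - s) (by rw [map_sub, hsh, sub_self])
    obtain ⟨α, hα⟩ := (memJ s).1 hs
    rw [memJ]
    refine ⟨α + aeval θ w, ?_⟩
    rw [show h = s + C (p : ℤ) * w by rw [← hw]; ring]
    simp [hα]; ring
  obtain ⟨d, hd⟩ := IsPrincipalIdealRing.principal (J.map π)
  rw [Ideal.submodule_span_eq] at hd
  obtain ⟨D, rfl⟩ := hsurj d
  have hDJ : D ∈ J := memI _ (by rw [hd]; exact Ideal.mem_span_singleton_self _)
  have hdf : π D ∣ π f := by
    rw [← Ideal.mem_span_singleton, ← hd]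
    exact Ideal.mem_map_of_mem _ ((memJ _).2 ⟨0, by simp [hroot]⟩)
  have hdg : π D ∣ π g := by
    rw [← Ideal.mem_span_singleton, ← hd]
    exact Ideal.mem_map_of_mem _ ((memJ _).2 ⟨y, hg⟩)
  have hfg : ¬ π f ∣ π g := by
    rintro ⟨u, hu⟩
    obtain ⟨u, rfl⟩ := hsurj u
    obtain ⟨w, hw⟩ := hker (g - f * u) (by rw [map_sub, map_mul, hu, sub_self])
    apply hy w
    have : aeval θ (g - f * u) = aeval θ (C (p : ℤ) * w) := by rw [hw]
    simp [hg, hroot] at this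
    rcases this with h | h
    · exact h.symm
    · exact absurd h (Fact.out : p.Prime).ne_zero
  obtain ⟨α, hα⟩ := (memJ _).1 hDJ
  obtain ⟨n, hn⟩ := nil_aux θ α f (C (p : ℤ)) D hdiv (hint α) (by simp [hα])
    ((Ideal.Quotient.mk (Ideal.span {π f})).comp π)
    (by simp) (by rw [RingHom.comp_apply, hπp, map_zero])
  rw [RingHom.comp_apply, ← map_pow, Ideal.Quotient.eq_zero_iff_mem,
    Ideal.mem_span_singleton] at hn
  obtain ⟨e, he⟩ := hdf
  have hf0 : π f ≠ 0 := by
    intro h0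
    apply hfg
    rw [h0] at hn
    have : π D = 0 := by
      refine (pow_eq_zero_iff (n := n) ?_).1 (zero_dvd_iff.1 hn)
      rintro rfl
      simp at hn
    rw [this] at hdg
    rw [h0]; exact hdg
  have heu : ¬ IsUnit e := by
    intro hu
    apply hfg
    exact (he ▸ (IsUnit.mul_right_dvd hu).2 dvd_rfl : π f ∣ π D).trans hdg
  obtain ⟨φ, hφm, hφ, e', he'⟩ := exists_monic_irreducible_factor e heu
  have hφf : φ ∣ π f := by rw [he, he']; exact ⟨π D * e', by ring⟩
  have hφD : φ ∣ π D := hφ.prime.dvd_of_dvd_pow (hφf.trans hn)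
  refine ⟨φ, hφm, hφ, ?_, ?_⟩
  · change _ ∣ π f
    rw [he, he']; exact mul_dvd_mul hφD ⟨e', rfl⟩
  · intro Φ H F hΦ hfe
    change π Φ = φ at hΦ
    change φ ∣ π F
    have hH : π H = π D * e' := by
      apply mul_left_cancel₀ hφ.ne_zero
      have : π f = π Φ * π H := by
        conv_lhs => rw [hfe]
        simp [hπp]
      rw [← hΦ, ← this, he, he', hΦ]; ring
    have hHJ : H ∈ J := memI _ (by
      rw [hd, hH]; exact Ideal.mem_span_singleton.2 ⟨e', rfl⟩)
    obtain ⟨β, hβ⟩ := (memJ _).1 hHJ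
    have key : aeval θ Φ * β = aeval θ (-F) := by
      have : aeval θ f = aeval θ (Φ * H + C (p : ℤ) * F) := by rw [← hfe]
      rw [hroot] at this
      simp [hβ] at this
      apply mul_left_cancel₀ hp0
      rw [map_neg]
      linear_combination -this
    obtain ⟨m, hm⟩ := nil_aux θ β f Φ (-F) hdiv (hint β) key
      ((Ideal.Quotient.mk (Ideal.span {φ})).comp π)
      (by simp [Ideal.Quotient.eq_zero_iff_mem, Ideal.mem_span_singleton, hφf])
      (by simp [Ideal.Quotient.eq_zero_iff_mem, Ideal.mem_span_singleton, hΦ])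
    rw [RingHom.comp_apply, ← map_pow, Ideal.Quotient.eq_zero_iff_mem,
      Ideal.mem_span_singleton] at hm
    have := hφ.prime.dvd_of_dvd_pow hm
    simpa using this

theorem descend {O : Type*} [CommRing O] (A : Subalgebra ℤ O) (n : ℕ) :
    n ≠ 0 → ∀ x : O, x ∉ A → (n : O) * x ∈ A →
    ∃ p : ℕ, p.Prime ∧ ∃ y : O, y ∉ A ∧ (p : O) * y ∈ A := by
  induction n using induction_on_primes with
  | zero => intro h; exact absurd rfl h
  | one => intro _ x hx h; simp at h; exact absurd h hx
  | prime_mul p a hp ih =>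
    intro h x hx hm
    by_cases hax : (a : O) * x ∈ A
    · exact ih (by rintro rfl; simp at h) x hx hax
    · exact ⟨p, hp, _, hax, by rw [← mul_assoc]; exact_mod_cast hm⟩

theorem clear_denoms {K : Type*} [Field K] [NumberField K] (θ x : 𝓞 K)
    (hgen : Algebra.adjoin ℚ ({(θ : K)} : Set K) = ⊤) :
    ∃ n : ℕ, n ≠ 0 ∧ (n : 𝓞 K) * x ∈ Algebra.adjoin ℤ ({θ} : Set (𝓞 K)) := by
  have hx : (x : K) ∈ Algebra.adjoin ℚ ({(θ : K)} : Set K) := by rw [hgen]; trivial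
  rw [Algebra.adjoin_singleton_eq_range_aeval] at hx
  obtain ⟨q, hq⟩ := hx
  obtain ⟨b, hb, hbq⟩ := IsLocalization.integerNormalization_spec (nonZeroDivisors ℤ) q
  set Q := IsLocalization.integerNormalization (nonZeroDivisors ℤ) q
  have hb0 : b ≠ 0 := nonZeroDivisors.ne_zero hb
  have h1 : (b : 𝓞 K) * x ∈ Algebra.adjoin ℤ ({θ} : Set (𝓞 K)) := by
    rw [Algebra.adjoin_singleton_eq_range_aeval]
    refine ⟨Q, ?_⟩
    apply RingOfIntegers.coe_injective
    have h2 : aeval (θ : K) (Q.map (algebraMap ℤ ℚ)) = aeval (θ : K) (b • q) := by rw [hbq]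
    rw [aeval_map_algebraMap, map_zsmul] at h2
    have h3 : aeval (θ : K) Q = ((aeval θ Q : 𝓞 K) : K) := aeval_algebraMap_apply K θ Q
    change ((aeval θ Q : 𝓞 K) : K) = _
    rw [← h3, h2]
    change b • (aeval (θ : K)).toRingHom q = _
    have hq' : (aeval (θ : K)).toRingHom q = x := hq
    rw [hq']
    simp
  refine ⟨b.natAbs, by simpa using hb0, ?_⟩
  obtain ⟨n, rfl | rfl⟩ := Int.eq_nat_or_neg b
  · simpa using h1
  · have := neg_mem h1
    simpa using this

theorem neg_case (a b : ℤ)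
    (f : ℤ[X]) (hf : f = X ^ 5 + C a * X + C b)
    {K : Type*} [Field K] [NumberField K] (θ : 𝓞 K)
    (hdiv : ∀ g : ℤ[X], aeval θ g = 0 → f ∣ g)
    (hroot : Polynomial.aeval θ f = 0) (p : ℕ) (hp : p.Prime) (r : ℤ)
    (h1 : (p : ℤ) ^ 2 ∣ r ^ 5 + a * r + b) (h2 : (p : ℤ) ∣ 5 * r ^ 4 + a) :
    Algebra.adjoin ℤ ({θ} : Set (𝓞 K)) ≠ ⊤ := by
  intro htop
  have : Fact p.Prime := ⟨hp⟩
  obtain ⟨s, hs⟩ := h1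
  obtain ⟨t, ht⟩ := h2
  have hr : θ ^ 5 + (a : 𝓞 K) * θ + (b : 𝓞 K) = 0 := by simpa [hf] using hroot
  have hs' : (r : 𝓞 K) ^ 5 + a * r + b = (p : 𝓞 K) ^ 2 * s := by exact_mod_cast congrArg (Int.cast (R := 𝓞 K)) hs
  have ht' : 5 * (r : 𝓞 K) ^ 4 + a = (p : 𝓞 K) * t := by exact_mod_cast congrArg (Int.cast (R := 𝓞 K)) ht
  let H : 𝓞 K := θ ^ 4 + r * θ ^ 3 + r ^ 2 * θ ^ 2 + r ^ 3 * θ + r ^ 4 + a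
  let G : 𝓞 K := θ ^ 3 + 2 * r * θ ^ 2 + 3 * r ^ 2 * θ + 4 * r ^ 3
  have hHG : H ^ 2 = p * t * H - p ^ 2 * s * G := by
    simp only [H, G]
    linear_combination (G + 0) * hr - G * hs' + H * ht'
  have hpK : (p : K) ≠ 0 := by exact_mod_cast hp.ne_zero
  have hint : IsIntegral (𝓞 K) ((H : K) / p) := by
    refine ⟨X ^ 2 + (C (-(t : 𝓞 K)) * X + C ((s : 𝓞 K) * G)), ?_, ?_⟩
    · apply monic_X_pow_add
      exact lt_of_le_of_lt degree_linear_le (by norm_num)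
    · have e := congrArg (algebraMap (𝓞 K) K) hHG
      simp only [map_pow, map_sub, map_mul, map_natCast, map_intCast] at e
      rw [eval₂_add, eval₂_add, eval₂_mul, eval₂_C, eval₂_C, eval₂_pow, eval₂_X]
      simp only [map_neg, map_mul]
      simp only [map_intCast]
      field_simp
      linear_combination e
  obtain ⟨y, hy⟩ := IsIntegrallyClosed.isIntegral_iff.1 hint
  have hpy : (p : 𝓞 K) * y = H := by
    apply RingOfIntegers.coe_injective
    change algebraMap (𝓞 K) K _ = algebraMap (𝓞 K) K _
    rw [map_mul, hy, map_natCast]; field_simp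
  have hyA : y ∈ Algebra.adjoin ℤ ({θ} : Set (𝓞 K)) := by rw [htop]; trivial
  rw [Algebra.adjoin_singleton_eq_range_aeval] at hyA
  obtain ⟨g, hg⟩ := hyA
  replace hg : aeval θ g = y := hg
  let P : ℤ[X] := X ^ 4 + (C r * X ^ 3 + C (r ^ 2) * X ^ 2 + C (r ^ 3) * X + C (r ^ 4 + a))
  have hd := hdiv (P - C (p : ℤ) * g) (by simp [P, hg, hpy, H]; ring)
  have hd2 := map_dvd (mapRingHom (Int.castRingHom (ZMod p))) hd
  have e1 : mapRingHom (Int.castRingHom (ZMod p)) (P - C (p : ℤ) * g) =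
      X ^ 4 + (C (r : ZMod p) * X ^ 3 + C ((r : ZMod p) ^ 2) * X ^ 2 + C ((r : ZMod p) ^ 3) * X
        + C ((r : ZMod p) ^ 4 + a)) := by
    simp [P]
  have e2 : mapRingHom (Int.castRingHom (ZMod p)) f =
      X ^ 5 + (C (a : ZMod p) * X + C (b : ZMod p)) := by
    simp [hf, add_assoc]
  rw [e1, e2] at hd2
  have d1 : (X ^ 4 + (C (r : ZMod p) * X ^ 3 + C ((r : ZMod p) ^ 2) * X ^ 2 + C ((r : ZMod p) ^ 3) * X
        + C ((r : ZMod p) ^ 4 + a))).natDegree = 4 := by compute_degree!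
  have d2 : (X ^ 5 + (C (a : ZMod p) * X + C (b : ZMod p))).natDegree = 5 := by compute_degree!
  have := natDegree_le_of_dvd hd2 (by intro h0; rw [h0] at d1; simp at d1)
  omega

theorem pos_case (a b : ℤ)
    (f : ℤ[X]) (hf : f = X ^ 5 + C a * X + C b)
    {K : Type*} [Field K] [NumberField K] (θ : 𝓞 K)
    (hdiv : ∀ g : ℤ[X], aeval θ g = 0 → f ∣ g)
    (hroot : Polynomial.aeval θ f = 0)
    (hgen : Algebra.adjoin ℚ ({(θ : K)} : Set K) = ⊤)
    (hne : Algebra.adjoin ℤ ({θ} : Set (𝓞 K)) ≠ ⊤) :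
    ∃ p : ℕ, p.Prime ∧ ∃ φ : (ZMod p)[X], Irreducible φ ∧
      φ ∣ X ^ 5 + C (a : ZMod p) * X + C (b : ZMod p) ∧
      φ ∣ 5 * X ^ 4 + C (a : ZMod p) ∧
      ∀ r : ℤ, φ ∣ X - C (r : ZMod p) →
        (p : ℤ) ^ 2 ∣ r ^ 5 + a * r + b ∧ (p : ℤ) ∣ 5 * r ^ 4 + a := by
  obtain ⟨x, hx⟩ : ∃ x, x ∉ Algebra.adjoin ℤ ({θ} : Set (𝓞 K)) := by
    by_contra! h
    exact hne (eq_top_iff.2 fun x _ => h x)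
  obtain ⟨n, hn, hnx⟩ := clear_denoms θ x hgen
  obtain ⟨p, hp, y, hy, hpy⟩ := descend _ n hn x hx hnx
  have : Fact p.Prime := ⟨hp⟩
  rw [Algebra.adjoin_singleton_eq_range_aeval] at hy hpy
  obtain ⟨g, hg⟩ := hpy
  obtain ⟨φ, hm, hi, hsq, hall⟩ := ded_core θ f (fun x => RingOfIntegers.isIntegral x) hdiv hroot p y
    (fun g hg => hy ⟨g, hg⟩) g hg
  have hfm : f.map (Int.castRingHom (ZMod p)) =
      X ^ 5 + C (a : ZMod p) * X + C (b : ZMod p) := by simp [hf]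
  have hder : derivative (f.map (Int.castRingHom (ZMod p))) = 5 * X ^ 4 + C (a : ZMod p) := by
    rw [hfm]; simp [map_ofNat C 4]; norm_num
  have hφ1 : φ ∣ X ^ 5 + C (a : ZMod p) * X + C (b : ZMod p) := by
    rw [← hfm]; exact (dvd_mul_right φ φ).trans hsq
  have hφ2 : φ ∣ 5 * X ^ 4 + C (a : ZMod p) := by
    rw [← hder]
    obtain ⟨w, hw⟩ := hsq
    rw [hw, derivative_mul, derivative_mul]
    exact ⟨derivative φ * w + derivative φ * w + φ * derivative w, by ring⟩
  refine ⟨p, hp, φ, hi, hφ1, hφ2, ?_⟩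
  intro r hr
  have hφ : φ = X - C (r : ZMod p) :=
    eq_of_monic_of_associated hm (monic_X_sub_C _)
      (hi.associated_of_dvd (irreducible_X_sub_C _) hr)
  have r1 := dvd_iff_isRoot.1 (hφ ▸ hφ1)
  have r2 := dvd_iff_isRoot.1 (hφ ▸ hφ2)
  simp only [IsRoot.def, eval_add, eval_mul, eval_pow, eval_X, eval_C, eval_ofNat] at r1 r2
  have r1' : (p : ℤ) ∣ r ^ 5 + a * r + b := by
    rw [← ZMod.intCast_zmod_eq_zero_iff_dvd]; push_cast; exact r1
  have r2' : (p : ℤ) ∣ 5 * r ^ 4 + a := by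
    rw [← ZMod.intCast_zmod_eq_zero_iff_dvd]; push_cast; exact r2
  refine ⟨?_, r2'⟩
  obtain ⟨k, hk⟩ := r1'
  have := hall (X - C r) (X ^ 4 + C r * X ^ 3 + C r ^ 2 * X ^ 2 + C r ^ 3 * X + C r ^ 4 + C a) (C k)
    (by simp [hφ]) (by
      rw [← C_mul, ← hk, hf]
      simp only [C_add, C_mul, C_pow]
      ring)
  rw [hφ, dvd_iff_isRoot] at this
  rw [map_C, IsRoot.def, eval_C, eq_intCast] at this
  obtain ⟨j, hj⟩ := (ZMod.intCast_zmod_eq_zero_iff_dvd _ _).1 this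
  exact ⟨j, by rw [hk, hj]; ring⟩

set_option maxRecDepth 100000 in
theorem mod25 : ∀ a b : ZMod 25, 5 * a = 0 → 5 * b ≠ 0 →
    ((-b) ^ 5 + a * (-b) + b = 0 ↔
      (b = 1 + a ∨ b = 7 + 2 * a ∨ b = 18 + 3 * a ∨ b = 24 + 4 * a)) := by
  decide

theorem mod25' (a b : ℤ) (ha : (5 : ℤ) ∣ a) (hb : ¬ (5 : ℤ) ∣ b) :
    ((5 : ℤ) ^ 2 ∣ (-b) ^ 5 + a * (-b) + b ↔
      (b ≡ 1 + a [ZMOD 25] ∨ b ≡ 7 + 2 * a [ZMOD 25] ∨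
              b ≡ 18 + 3 * a [ZMOD 25] ∨ b ≡ 24 + 4 * a [ZMOD 25])) := by
  have h := mod25 a b (by
    have : ((5 * a : ℤ) : ZMod 25) = 0 := by
      rw [ZMod.intCast_zmod_eq_zero_iff_dvd]; push_cast; omega
    exact_mod_cast this) (by
    intro h
    have : ((5 * b : ℤ) : ZMod 25) = 0 := by exact_mod_cast h
    rw [ZMod.intCast_zmod_eq_zero_iff_dvd] at this
    push_cast at this; omega)
  have e : ∀ x y : ℤ, x ≡ y [ZMOD 25] ↔ (x : ZMod 25) = (y : ZMod 25) :=
    fun x y => (ZMod.intCast_eq_intCast_iff x y 25).symm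
  rw [e, e, e, e]
  push_cast
  rw [← h]
  have := ZMod.intCast_zmod_eq_zero_iff_dvd ((-b) ^ 5 + a * (-b) + b) 25
  push_cast at this
  rw [this]

theorem disc_dvd (a b r p : ℤ) (h1 : p ^ 2 ∣ r ^ 5 + a * r + b) (h2 : p ∣ 5 * r ^ 4 + a) :
    p ^ 2 ∣ 2 ^ 8 * a ^ 5 + 5 ^ 5 * b ^ 4 := by
  obtain ⟨s, hs⟩ := h1
  obtain ⟨t, ht⟩ := h2
  have ha : a = p * t - 5 * r ^ 4 := by linarith
  have hb : b = p ^ 2 * s + (4 * r ^ 5 - p * t * r) := by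
    have : b = p ^ 2 * s - r ^ 5 - a * r := by linarith
    rw [this, ha]; ring
  have hb' : p ^ 2 ∣ b ^ 4 - (4 * r ^ 5 - p * t * r) ^ 4 :=
    dvd_trans ⟨s, by rw [hb]; ring⟩ (sub_dvd_pow_sub_pow b (4 * r ^ 5 - p * t * r) 4)
  obtain ⟨w, hw⟩ := hb'
  have hbw : b ^ 4 = p ^ 2 * w + (4 * r ^ 5 - p * t * r) ^ 4 := by linarith
  rw [hbw, ha]
  exact ⟨t ^ 2 * (256 * (p * t) ^ 3 - 3275 * (p * t) ^ 2 * r ^ 4 + 14000 * (p * t) * r ^ 8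
    - 20000 * r ^ 12) + 3125 * w, by ring⟩

theorem main_aux (a b : ℤ)
    (f : ℤ[X]) (hf : f = X ^ 5 + C a * X + C b)
    (hirr : Irreducible (f.map (Int.castRingHom ℚ)))
    {K : Type*} [Field K] [NumberField K] (θ : 𝓞 K)
    (hroot : Polynomial.aeval θ f = 0) : ∀ g : ℤ[X], aeval θ g = 0 → f ∣ g := by
  intro g hg
  have hmon : f.Monic := by
    rw [hf, add_assoc]
    apply monic_X_pow_add
    exact lt_of_le_of_lt degree_linear_le (by norm_num)
  have hi : Irreducible f := (IsPrimitive.Int.irreducible_iff_irreducible_map_cast hmon.isPrimitive).2 hirr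
  have hint : IsIntegral ℤ θ := RingOfIntegers.isIntegral θ
  have h1 := minpoly.isIntegrallyClosed_dvd hint hroot
  have h2 := minpoly.isIntegrallyClosed_dvd hint hg
  have h3 := minpoly.not_isUnit ℤ θ
  rcases hi.dvd_iff.1 h1 with h | h
  · exact absurd h h3
  · exact h.dvd.trans h2

theorem stmt8 (a b : ℤ)
    (f : ℤ[X]) (hf : f = X ^ 5 + C a * X + C b)
    (hirr : Irreducible (f.map (Int.castRingHom ℚ)))
    (hsf : Squarefree ((2 ^ 8 * a ^ 5 + 5 ^ 5 * b ^ 4) /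
      (Int.gcd (2 ^ 8 * a ^ 5) (5 ^ 5 * b ^ 4) : ℤ)))
    (K : Type*) [Field K] [NumberField K] (θ : NumberField.RingOfIntegers K)
    (hroot : Polynomial.aeval θ f = 0)
    (hgen : Algebra.adjoin ℚ ({(θ : K)} : Set K) = ⊤) :
    Algebra.adjoin ℤ ({θ} : Set (NumberField.RingOfIntegers K)) = ⊤ ↔
      ∀ p : ℕ, p.Prime → (p : ℤ) ∣ 2 * a → (p : ℤ) ∣ 5 * b →
        (((p : ℤ) ∣ a ∧ (p : ℤ) ∣ b ∧ ¬ (p : ℤ) ^ 2 ∣ b) ∨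
          (p = 2 ∧ ¬ (2 : ℤ) ∣ a ∧ a + b ≡ 1 [ZMOD 4]) ∨
          (p = 5 ∧ ¬ (5 : ℤ) ∣ b ∧
            ¬ (b ≡ 1 + a [ZMOD 25] ∨ b ≡ 7 + 2 * a [ZMOD 25] ∨
              b ≡ 18 + 3 * a [ZMOD 25] ∨ b ≡ 24 + 4 * a [ZMOD 25]))) := by
  have hdiv := main_aux a b f hf hirr θ hroot
  constructor
  · intro htop p hp hpa hpb
    by_contra hcon
    have hneg := fun r h1 h2 => neg_case a b f hf θ hdiv hroot p hp r h1 h2 htop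
    push Not at hcon
    obtain ⟨c1, c2, c3⟩ := hcon
    have hpi : Prime (p : ℤ) := Nat.prime_iff_prime_int.1 hp
    by_cases hab : (p : ℤ) ∣ a ∧ (p : ℤ) ∣ b
    · exact hneg 0 (by simpa using c1 hab.1 hab.2) (by simpa using hab.1)
    · rcases hpi.dvd_or_dvd hpa with h | h
      · have hp2 : p = 2 := (Nat.prime_dvd_prime_iff_eq hp Nat.prime_two).1 (by exact_mod_cast h)
        subst hp2
        push_cast at hpa hpb c1 hab hneg
        have hb : (2 : ℤ) ∣ b := by omega
        have ha : ¬ (2 : ℤ) ∣ a := fun h => hab ⟨h, hb⟩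
        have c := c2 rfl ha
        refine hneg (-1) ?_ ?_
        · have : ¬ (a + b) % 4 = 1 % 4 := c
          norm_num; omega
        · norm_num; omega
      · have hb : ¬ (p : ℤ) ∣ b := fun hb => hab ⟨h, hb⟩
        have h5 := (hpi.dvd_or_dvd hpb).resolve_right hb
        have hp5 : p = 5 := (Nat.prime_dvd_prime_iff_eq hp Nat.prime_five).1 (by exact_mod_cast h5)
        subst hp5
        push_cast at h hb hneg
        refine hneg (-b) ?_ ?_
        · rw [show (25 : ℤ) = 5 ^ 2 by norm_num, mod25' a b h hb]
          by_contra hc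
          exact absurd (c3 rfl hb) hc
        · exact dvd_add (dvd_mul_right _ _) h
  · intro hcond
    by_contra hne
    obtain ⟨p, hp, φ, hi, hφ1, hφ2, hr⟩ := pos_case a b f hf θ hdiv hroot hgen hne
    have : Fact p.Prime := ⟨hp⟩
    have hpi : Prime (p : ℤ) := Nat.prime_iff_prime_int.1 hp
    have hcast : ∀ x : ℤ, (x : ZMod p) = 0 ↔ (p : ℤ) ∣ x :=
      fun x => ZMod.intCast_zmod_eq_zero_iff_dvd x p
    by_cases hpd : (p : ℤ) ∣ 2 * a ∧ (p : ℤ) ∣ 5 * b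
    · rcases hcond p hp hpd.1 hpd.2 with ⟨h1, h2, h3⟩ | ⟨h1, h2, h3⟩ | ⟨h1, h2, h3⟩
      · rw [(hcast a).2 h1, (hcast b).2 h2] at hφ1
        have : φ ∣ X := hi.prime.dvd_of_dvd_pow (n := 5) (by simpa using hφ1)
        have := (hr 0 (by simpa using this)).1
        exact h3 (by simpa using this)
      · subst h1
        have ha : (a : ZMod 2) = 1 := by
          have : ((a - 1 : ℤ) : ZMod 2) = 0 := by rw [hcast]; push_cast; omega
          push_cast at this; exact sub_eq_zero.1 this
        have h20 : (2 : (ZMod 2)[X]) = 0 := by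
          rw [← map_ofNat (C : ZMod 2 →+* _) 2, show (OfNat.ofNat 2 : ZMod 2) = 0 from rfl, C_0]
        have : φ ∣ X + 1 := by
          apply hi.prime.dvd_of_dvd_pow (n := 4)
          convert hφ2 using 1
          rw [ha, C_1]
          linear_combination (-2 * X ^ 4 + 2 * X ^ 3 + 3 * X ^ 2 + 2 * X) * h20
        have h := (hr (-1) (by rw [Int.cast_neg, Int.cast_one, C_neg, C_1, sub_neg_eq_add]; exact this)).1
        have h3' : (a + b) % 4 = 1 % 4 := h3
        norm_num at h
        omega
      · subst h1
        have ha : (5 : ℤ) ∣ a := by have := hpd.1; push_cast at this; omega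
        have : φ ∣ X + C (b : ZMod 5) := by
          apply hi.prime.dvd_of_dvd_pow (n := 5)
          rw [add_pow_char, ← C_pow, ZMod.pow_card]
          rw [(hcast a).2 ha] at hφ1
          simpa using hφ1
        have h := (hr (-b) (by simpa using this)).1
        push_cast at h
        exact h3 ((mod25' a b ha h2).1 h)
    · have hlin : φ ∣ C (4 * a : ZMod p) * X + C (5 * b : ZMod p) := by
        have := dvd_sub (hφ1.mul_left 5) (hφ2.mul_left X)
        convert this using 1
        simp only [C_mul, map_ofNat]
        ring
      by_cases h2a : (p : ℤ) ∣ 2 * a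
      · have h5b : ¬ (p : ℤ) ∣ 5 * b := fun h => hpd ⟨h2a, h⟩
        have e1 : (4 * a : ZMod p) = 0 := by
          have := (hcast (4 * a)).2 (by rw [show 4 * a = 2 * (2 * a) by ring]; exact h2a.mul_left 2)
          exact_mod_cast this
        have e2 : (5 * b : ZMod p) ≠ 0 := by
          intro h; exact h5b ((hcast _).1 (by exact_mod_cast h))
        rw [e1, C_0, zero_mul, zero_add] at hlin
        exact hi.not_isUnit (isUnit_of_dvd_unit hlin (isUnit_C.2 (isUnit_iff_ne_zero.2 e2)))
      · have h4a : ¬ (p : ℤ) ∣ 4 * a := by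
          intro h
          rcases hpi.dvd_or_dvd (show (p : ℤ) ∣ 2 * (2 * a) by rw [← mul_assoc]; exact h) with h | h
          · exact h2a (h.mul_right a)
          · exact h2a h
        have e1 : (4 * a : ZMod p) ≠ 0 := by
          intro h; exact h4a ((hcast _).1 (by exact_mod_cast h))
        obtain ⟨r, hrr⟩ := ZMod.intCast_surjective (-(5 * b : ZMod p) / (4 * a : ZMod p))
        have hd : φ ∣ X - C (r : ZMod p) := by
          have e3 : C (4 * a : ZMod p) * X + C (5 * b : ZMod p)
              = C (4 * a : ZMod p) * (X - C (r : ZMod p)) := by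
            rw [mul_sub, ← C_mul, hrr, mul_div_cancel₀ _ e1, C_neg, sub_neg_eq_add]
          rw [e3] at hlin
          exact (IsUnit.dvd_mul_left (isUnit_C.2 (isUnit_iff_ne_zero.2 e1))).1 hlin
        have hD := disc_dvd a b r p (hr r hd).1 (hr r hd).2
        set g : ℤ := (Int.gcd (2 ^ 8 * a ^ 5) (5 ^ 5 * b ^ 4) : ℤ) with hg
        have g1 : g ∣ 2 ^ 8 * a ^ 5 := Int.gcd_dvd_left ..
        have g2 : g ∣ 5 ^ 5 * b ^ 4 := Int.gcd_dvd_right ..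
        have hpg : ¬ (p : ℤ) ∣ g := by
          intro h
          have h := h.trans g1
          rcases hpi.dvd_or_dvd h with h | h
          · exact h2a ((hpi.dvd_of_dvd_pow h).mul_right a)
          · exact h2a ((hpi.dvd_of_dvd_pow h).mul_left 2)
        obtain ⟨q, hq⟩ := dvd_add g1 g2
        have hg0 : g ≠ 0 := by rintro h; rw [h] at hpg; simp at hpg
        rw [hq, Int.mul_ediv_cancel_left _ hg0] at hsf
        rw [hq] at hD
        have hcop : IsCoprime ((p : ℤ) ^ 2) g :=
          IsCoprime.pow_left ((Prime.coprime_iff_not_dvd hpi).2 hpg)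
        have := hcop.dvd_of_dvd_mul_left hD
        rw [pow_two] at this
        exact hpi.not_isUnit (hsf _ this)
end

section
/- Let f(x) = x^6 + a x + b ∈ ℤ[x] be irreducible with 2 | a and 2 ∤ b, and let θ be a root. Then 2 does not divide the index [O_{ℚ(θ)} : ℤ[θ]] if and only if a + b ≡ 1 (mod 4). -/
open Polynomial NumberField

section helpers
variable {K : Type*} [Field K] [NumberField K]

lemma mem_order (θ x : 𝓞 K) :
    x ∈ (Algebra.adjoin ℤ ({θ} : Set (𝓞 K))).toSubring.toAddSubgroup ↔
      ∃ P : ℤ[X], aeval θ P = x := by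
  change x ∈ Algebra.adjoin ℤ ({θ} : Set (𝓞 K)) ↔ _
  rw [Algebra.adjoin_singleton_eq_range_aeval]
  rfl

lemma dvd_of_root (f : ℤ[X]) (hm : f.Monic)
    (hirr : Irreducible (f.map (Int.castRingHom ℚ))) (θ : 𝓞 K)
    (hroot : aeval θ f = 0) (P : ℤ[X]) (hP : aeval θ P = 0) : f ∣ P := by
  have key : ∀ Q : ℤ[X], aeval θ Q = 0 → aeval (θ : K) (Q.map (Int.castRingHom ℚ)) = 0 := by
    intro Q hQ
    have h1 : aeval (algebraMap (𝓞 K) K θ) Q = 0 := by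
      rw [aeval_algebraMap_apply, hQ, map_zero]
    rw [← h1]
    exact aeval_map_algebraMap ℚ _ Q
  have hmin := minpoly.eq_of_irreducible_of_monic hirr (key f hroot) (hm.map _)
  have := minpoly.dvd ℚ (θ : K) (key P hP)
  rw [← hmin] at this
  exact (map_dvd_map _ (RingHom.injective_int _) hm).1 this

lemma exists_mul_mem (θ : 𝓞 K) (hgen : Algebra.adjoin ℚ ({(θ : K)} : Set K) = ⊤) (x : 𝓞 K) :
    ∃ n : ℤ, n ≠ 0 ∧ ∃ P : ℤ[X], aeval θ P = n • x := by
  have hx : (x : K) ∈ Algebra.adjoin ℚ ({(θ : K)} : Set K) := by rw [hgen]; trivial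
  rw [Algebra.adjoin_singleton_eq_range_aeval] at hx
  obtain ⟨p, hp⟩ := hx
  obtain ⟨n, hn, h⟩ := IsLocalization.integerNormalization_spec (nonZeroDivisors ℤ) p
  refine ⟨n, nonZeroDivisors.ne_zero hn,
    IsLocalization.integerNormalization (nonZeroDivisors ℤ) p, ?_⟩
  apply RingOfIntegers.coe_injective
  have h3 := aeval_map_algebraMap ℚ (θ : K)
    (IsLocalization.integerNormalization (nonZeroDivisors ℤ) p)
  have hp' : aeval (θ : K) p = x := hp
  rw [h, map_zsmul, hp'] at h3
  rw [← aeval_algebraMap_apply, map_zsmul]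
  exact h3.symm

lemma index_ne_zero (θ : 𝓞 K) (hgen : Algebra.adjoin ℚ ({(θ : K)} : Set K) = ⊤) :
    indexZTheta θ ≠ 0 := by
  unfold indexZTheta
  set S := (Algebra.adjoin ℤ ({θ} : Set (𝓞 K))).toSubring.toAddSubgroup with hS
  let N : Submodule ℤ (𝓞 K) := AddSubgroup.toIntSubmodule S
  have ht : Module.IsTorsion ℤ (𝓞 K ⧸ N) := by
    intro x
    obtain ⟨x, rfl⟩ := Submodule.Quotient.mk_surjective N x
    obtain ⟨n, hn, hP⟩ := exists_mul_mem θ hgen x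
    refine ⟨⟨n, mem_nonZeroDivisors_of_ne_zero hn⟩, ?_⟩
    change n • (Submodule.Quotient.mk x : 𝓞 K ⧸ N) = 0
    rw [← Submodule.Quotient.mk_smul, Submodule.Quotient.mk_eq_zero]
    exact (mem_order θ _).2 hP
  have hfin : Finite (𝓞 K ⧸ N) := Module.finite_of_fg_torsion (𝓞 K ⧸ N) ht
  have : Finite (𝓞 K ⧸ S) := hfin
  have : S.FiniteIndex := AddSubgroup.finiteIndex_of_finite_quotient
  exact this.index_ne_zero

lemma two_dvd_index (θ x : 𝓞 K) (h2 : ∃ P : ℤ[X], aeval θ P = 2 * x)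
    (h1 : ¬ ∃ P : ℤ[X], aeval θ P = x) : 2 ∣ indexZTheta θ := by
  unfold indexZTheta
  rw [← mem_order] at h1 h2
  set S := (Algebra.adjoin ℤ ({θ} : Set (𝓞 K))).toSubring.toAddSubgroup with hS
  have : addOrderOf (QuotientAddGroup.mk x : 𝓞 K ⧸ S) = 2 := by
    refine addOrderOf_eq_prime ?_ ?_
    · rw [← QuotientAddGroup.mk_nsmul, QuotientAddGroup.eq_zero_iff, nsmul_eq_mul]
      exact_mod_cast h2
    · rwa [ne_eq, QuotientAddGroup.eq_zero_iff]
  rw [← this]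
  exact addOrderOf_dvd_natCard _

lemma exists_of_two_dvd (θ : 𝓞 K) (hgen : Algebra.adjoin ℚ ({(θ : K)} : Set K) = ⊤)
    (h : 2 ∣ indexZTheta θ) :
    ∃ x : 𝓞 K, (∃ P : ℤ[X], aeval θ P = 2 * x) ∧ ¬ ∃ P : ℤ[X], aeval θ P = x := by
  have h0 := index_ne_zero θ hgen
  unfold indexZTheta at h h0
  simp only [← mem_order]
  set S := (Algebra.adjoin ℤ ({θ} : Set (𝓞 K))).toSubring.toAddSubgroup with hS
  have : S.FiniteIndex := ⟨h0⟩
  have : Finite (𝓞 K ⧸ S) := AddSubgroup.finite_quotient_of_finiteIndex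
  have : Fact (Nat.Prime 2) := ⟨Nat.prime_two⟩
  obtain ⟨y, hy⟩ := exists_prime_addOrderOf_dvd_card' (G := 𝓞 K ⧸ S) 2 h
  obtain ⟨x, rfl⟩ := QuotientAddGroup.mk_surjective y
  refine ⟨x, ?_, ?_⟩
  · have := addOrderOf_nsmul_eq_zero (QuotientAddGroup.mk x : 𝓞 K ⧸ S)
    rw [hy, ← QuotientAddGroup.mk_nsmul, QuotientAddGroup.eq_zero_iff, nsmul_eq_mul] at this
    exact_mod_cast this
  · intro hx
    rw [(QuotientAddGroup.eq_zero_iff x).2 hx] at hy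
    simp at hy

lemma two_pow_mem (θ : 𝓞 K) (P : ℤ[X]) (η : 𝓞 K) (h : aeval θ P = 2 * η) :
    ∃ n : ℕ, ∃ T : ℤ[X], aeval θ (P ^ n - C 2 * T) = 0 := by
  obtain ⟨q, hq, hq0⟩ := (RingOfIntegers.isIntegral η : IsIntegral ℤ η)
  refine ⟨q.natDegree, -∑ i ∈ Finset.range q.natDegree,
    C (q.coeff i * 2 ^ (q.natDegree - 1 - i)) * P ^ i, ?_⟩
  rw [eval₂_eq_sum_range, Finset.sum_range_succ, hq.coeff_natDegree] at hq0
  have e : (2:𝓞 K) ^ q.natDegree * η ^ q.natDegree + ∑ i ∈ Finset.range q.natDegree,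
      (2:𝓞 K) ^ q.natDegree * ((algebraMap ℤ (𝓞 K) (q.coeff i)) * η ^ i) = 0 := by
    rw [← Finset.mul_sum, ← mul_add, add_comm]
    simp only [map_one, one_mul] at hq0
    rw [hq0, mul_zero]
  rw [← e]
  rw [mul_neg, sub_neg_eq_add, map_add, map_mul, map_sum, map_pow, h, mul_pow, Finset.mul_sum]
  congr 1
  refine Finset.sum_congr rfl fun i hi => ?_
  obtain ⟨d, hd⟩ := Nat.exists_eq_add_of_lt (Finset.mem_range.1 hi)
  rw [hd, show i + d + 1 - 1 - i = d by omega]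
  rw [map_mul, map_pow, h, aeval_C, aeval_C]
  simp only [algebraMap_int_eq, eq_intCast, Int.cast_ofNat, Int.cast_mul, Int.cast_pow]
  ring

lemma g_dvd (a b : ℤ) (ha : (2 : ℤ) ∣ a) (hb : ¬ (2 : ℤ) ∣ b)
    (f : ℤ[X]) (hf : f = X ^ 6 + C a * X + C b) (hm : f.Monic)
    (hirr : Irreducible (f.map (Int.castRingHom ℚ))) (θ : 𝓞 K)
    (hroot : aeval θ f = 0) (P : ℤ[X]) (k : ℕ) (η : 𝓞 K) (hP : aeval θ (P ^ k) = 2 * η) :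
    ∃ Q S : ℤ[X], P = (X ^ 3 + 1) * Q + C 2 * S := by
  obtain ⟨n, T, hT⟩ := two_pow_mem θ (P ^ k) η hP
  obtain ⟨R, hR⟩ := dvd_of_root f hm hirr θ hroot _ hT
  obtain ⟨a', rfl⟩ := ha
  obtain ⟨b', rfl⟩ : Odd b := by rwa [← Int.not_even_iff_odd, even_iff_two_dvd]
  have two : (2 : (ZMod 2)[X]) = 0 := by exact_mod_cast CharP.cast_eq_zero (ZMod 2)[X] 2
  have hz : C (2 : ZMod 2) = 0 := two
  have hsep : (X ^ 3 + 1 : (ZMod 2)[X]).Separable := by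
    refine ⟨1, X, ?_⟩
    simp only [derivative_add, derivative_X_pow, derivative_one]
    rw [C_eq_natCast]
    push_cast
    linear_combination (2 * X ^ 3) * two
  have hd : (X ^ 3 + 1 : (ZMod 2)[X]) ∣ (P.map (Int.castRingHom (ZMod 2))) ^ (k * n) := by
    have := congrArg (Polynomial.map (Int.castRingHom (ZMod 2))) hR
    simp [hf, hz, Polynomial.map_sub, two] at this
    rw [pow_mul, this]
    refine Dvd.dvd.mul_right ⟨X ^ 3 + 1, ?_⟩ _
    linear_combination (-X ^ 3) * two
  obtain ⟨q, hq⟩ := hsep.squarefree.isRadical _ _ hd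
  obtain ⟨Q, rfl⟩ := map_surjective (Int.castRingHom (ZMod 2)) (ZMod.intCast_surjective) q
  have h0 : (P - (X ^ 3 + 1) * Q).map (Int.castRingHom (ZMod 2)) = 0 := by
    simp [hq]
  have : C 2 ∣ P - (X ^ 3 + 1) * Q := by
    rw [C_dvd_iff_dvd_coeff]
    intro i
    have := congrArg (fun p => coeff p i) h0
    simp only [coeff_map, coeff_zero, eq_intCast] at this
    exact_mod_cast (ZMod.intCast_zmod_eq_zero_iff_dvd _ 2).1 this
  obtain ⟨S, hS⟩ := this
  exact ⟨Q, S, by rw [← hS]; ring⟩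

end helpers

theorem stmt9 (a b : ℤ) (ha : (2 : ℤ) ∣ a) (hb : ¬ (2 : ℤ) ∣ b)
    (f : ℤ[X]) (hf : f = X ^ 6 + C a * X + C b)
    (hirr : Irreducible (f.map (Int.castRingHom ℚ)))
    (K : Type*) [Field K] [NumberField K] (θ : NumberField.RingOfIntegers K)
    (hroot : Polynomial.aeval θ f = 0)
    (hgen : Algebra.adjoin ℚ ({(θ : K)} : Set K) = ⊤) :
    ¬ 2 ∣ indexZTheta θ ↔ a + b ≡ 1 [ZMOD 4] := by
  have hm : f.Monic := by rw [hf]; monicity!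
  have hroot' : θ ^ 6 + a * θ + b = 0 := by simpa [hf] using hroot
  constructor
  · intro h
    by_contra hab
    apply h
    obtain ⟨m, hm4⟩ : (4 : ℤ) ∣ 1 + a + b := by
      rw [Int.ModEq] at hab; omega
    obtain ⟨a', rfl⟩ := ha
    have hK : (θ : K) ^ 6 + (2 * a' : ℤ) * (θ : K) + b = 0 := by
      have := congrArg (algebraMap (𝓞 K) K) hroot'
      simpa [map_ofNat] using this
    have hm4' : (1 + 2 * a' + b : K) = 4 * m := by exact_mod_cast congrArg (Int.cast : ℤ → K) hm4
    push_cast at hK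
    let h : ℤ[X] := X ^ 5 + X ^ 4 + X ^ 3 + X ^ 2 + X + C (1 + 2 * a')
    have hint : IsIntegral (𝓞 K) (((θ : K) ^ 5 + θ ^ 4 + θ ^ 3 + θ ^ 2 + θ + (1 + 2 * a')) / 2) := by
      obtain ⟨r, hr⟩ : ∃ r : 𝓞 K, r = -(3 + a') := ⟨_, rfl⟩
      obtain ⟨t, ht⟩ : ∃ t : 𝓞 K, t = m * (θ ^ 4 + 2 * θ ^ 3 + 3 * θ ^ 2 + 4 * θ + 5) :=
        ⟨_, rfl⟩
      refine ⟨X ^ 2 + (C r * X + C t), ?_, ?_⟩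
      · monicity!
      · simp only [eval₂_add, eval₂_mul, eval₂_pow, eval₂_X, eval₂_C]
        simp only [hr, ht, map_add, map_mul, map_neg,
          map_pow, map_ofNat, map_intCast]
        field_simp
        linear_combination ((θ : K) ^ 4 + 2 * θ ^ 3 + 3 * θ ^ 2 + 4 * θ + 5) * (hK - hm4')
    obtain ⟨η, hη⟩ := IsIntegrallyClosed.isIntegral_iff.1 hint
    have hη2 : aeval θ h = 2 * η := by
      apply RingOfIntegers.coe_injective
      simp only [map_mul, map_ofNat, hη, h]
      simp only [map_add, map_mul, map_pow, aeval_X, aeval_C, algebraMap_int_eq, eq_intCast,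
        map_intCast]
      push_cast
      field_simp
    refine two_dvd_index θ η ⟨h, hη2⟩ ?_
    rintro ⟨T, hT⟩
    obtain ⟨R, hR⟩ := dvd_of_root f hm hirr θ hroot (h - C 2 * T) (by
      simp [hη2, hT, map_ofNat])
    have two : (2 : (ZMod 2)[X]) = 0 := by exact_mod_cast CharP.cast_eq_zero (ZMod 2)[X] 2
    have hz : C (2 : ZMod 2) = 0 := two
    have hd : f.map (Int.castRingHom (ZMod 2)) ∣ h.map (Int.castRingHom (ZMod 2)) := by
      refine ⟨R.map (Int.castRingHom (ZMod 2)), ?_⟩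
      rw [← Polynomial.map_mul, ← hR]
      simp [two, hz]
    have hhm : h.Monic := by simp only [h]; monicity!
    have := natDegree_le_of_dvd hd (hhm.map _).ne_zero
    rw [hm.natDegree_map, hhm.natDegree_map] at this
    have d1 : f.natDegree = 6 := by rw [hf]; compute_degree!
    have d2 : h.natDegree = 5 := by simp only [h]; compute_degree!
    omega
  · intro hab h
    obtain ⟨x, ⟨P, hP⟩, hx⟩ := exists_of_two_dvd θ hgen h
    apply hx
    have L := g_dvd a b ha hb f hf hm hirr θ hroot
    obtain ⟨Q, S, rfl⟩ := L P 1 x (by rwa [pow_one])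
    have hab' := hab.dvd
    obtain ⟨a', rfl⟩ := ha
    obtain ⟨b', rfl⟩ : Odd b := by rwa [← Int.not_even_iff_odd, even_iff_two_dvd]
    push_cast at hroot'
    obtain ⟨F, hF⟩ : ∃ F : 𝓞 K, F = -θ ^ 3 + a' * θ + b' := ⟨_, rfl⟩
    have hg2 : (θ ^ 3 + 1) ^ 2 = -2 * F := by rw [hF]; linear_combination hroot'
    obtain ⟨u, v, w, huvw⟩ : ∃ u v w : 𝓞 K, u * F + v * (θ ^ 3 + 1) + 2 * w = 1 := by
      rcases Int.even_or_odd' a' with ⟨k, rfl | rfl⟩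
      · obtain ⟨l, rfl⟩ : (2:ℤ) ∣ b' := by omega
        refine ⟨1, 1, -(k * θ + l), ?_⟩
        rw [hF]; push_cast; ring
      · obtain ⟨l, rfl⟩ : Odd b' := by rw [Int.odd_iff]; omega
        refine ⟨-θ ^ 2, -θ ^ 2 + 1, θ ^ 2 + k * θ ^ 3 + l * θ ^ 2, ?_⟩
        rw [hF]; push_cast; ring
    obtain ⟨q, hq⟩ : ∃ q, q = aeval θ Q := ⟨_, rfl⟩
    obtain ⟨s, hs⟩ : ∃ s, s = aeval θ S := ⟨_, rfl⟩
    have hP' : (θ ^ 3 + 1) * q + 2 * s = 2 * x := by rw [hq, hs, ← hP]; simp [map_ofNat]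
    have hFq : F * q = (θ ^ 3 + 1) * (s - x) := by
      have : (2 : 𝓞 K) ≠ 0 := two_ne_zero
      apply mul_left_cancel₀ this
      linear_combination (-(θ ^ 3 + 1)) * hP' + q * hg2
    have hqq : q = (θ ^ 3 + 1) * (u * (s - x) + v * q) + 2 * (w * q) := by
      linear_combination (-q) * huvw + u * hFq
    obtain ⟨τ, σ, hτ⟩ : ∃ τ σ : 𝓞 K, q = (θ ^ 3 + 1) * τ + 2 * σ := ⟨_, _, hqq⟩
    have hQ2 : aeval θ (Q ^ 2) = 2 * (-F * τ ^ 2 + 2 * (θ ^ 3 + 1) * τ * σ + 2 * σ ^ 2) := by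
      rw [map_pow, ← hq, hτ]
      linear_combination τ ^ 2 * hg2
    obtain ⟨Q1, S1, h1⟩ := L Q 2 _ hQ2
    refine ⟨-(-X ^ 3 + C a' * X + C b') * Q1 + (X ^ 3 + 1) * S1 + S, ?_⟩
    have hq1 : q = (θ ^ 3 + 1) * aeval θ Q1 + 2 * aeval θ S1 := by
      rw [hq, h1]; simp [map_ofNat]
    have e : aeval θ (-(-X ^ 3 + C a' * X + C b') * Q1 + (X ^ 3 + 1) * S1 + S) =
        -F * aeval θ Q1 + (θ ^ 3 + 1) * aeval θ S1 + s := by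
      rw [hF, hs]; simp
    rw [e]
    apply mul_left_cancel₀ (two_ne_zero : (2 : 𝓞 K) ≠ 0)
    linear_combination hP' - (θ ^ 3 + 1) * hq1 - aeval θ Q1 * hg2
end

section
/- Let g(x) = x^5 + c x^4 + d ∈ ℤ[x] be irreducible with θ a root, and suppose (5^5 d + 2^8 c^5)/gcd(5^5 d, 2^8 c^5) is square-free. Then ℤ[θ] is the full ring of integers of ℚ(θ) if and only if d is square-free and, whenever 5 | c and 5 ∤ d, c + d is not congruent to 1, 7, 18, or 24 modulo 25. -/
open Polynomial NumberField

/-- If `z` is integral, `y * z` lies in `ℤ[θ]`, then some power of `y * z` lies in `y ℤ[θ]`. -/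
lemma aux_pow {B : Type*} [CommRing B] (θ z : B) (hz : IsIntegral ℤ z) (Y F : ℤ[X])
    (h : aeval θ F = aeval θ Y * z) :
    ∃ (n : ℕ) (r : ℤ[X]), aeval θ (F ^ n) = aeval θ (Y * r) := by
  obtain ⟨P, hP, hPz⟩ := hz
  rw [← aeval_def] at hPz
  refine ⟨P.natDegree,
    - ∑ i ∈ Finset.range P.natDegree, C (P.coeff i) * F ^ i * Y ^ (P.natDegree - i - 1), ?_⟩
  have e := hP.as_sum
  have e2 : (aeval z P) = z ^ P.natDegree +
      ∑ i ∈ Finset.range P.natDegree, (P.coeff i : B) * z ^ i := by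
    conv_lhs => rw [e]
    simp
  rw [e2] at hPz
  have hz' : z ^ P.natDegree = - ∑ i ∈ Finset.range P.natDegree, (P.coeff i : B) * z ^ i :=
    eq_neg_of_add_eq_zero_left hPz
  simp only [map_pow, map_mul, map_neg, map_sum, h, mul_pow, hz']
  rw [mul_neg, mul_neg, Finset.mul_sum, Finset.mul_sum]
  congr 1
  refine Finset.sum_congr rfl fun i hi => ?_
  have hi' := Finset.mem_range.mp hi
  have : P.natDegree = i + (P.natDegree - i - 1) + 1 := by omega
  have e3 : (aeval θ Y) ^ P.natDegree = aeval θ Y ^ i * aeval θ Y ^ (P.natDegree - i - 1) * aeval θ Y := by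
    conv_lhs => rw [this]
    ring
  rw [e3]
  simp
  ring

/-- The backward direction of the Dedekind-type criterion. -/
lemma aux_back {B : Type*} [CommRing B] [IsDomain B] [CharZero B] (θ : B) (g : ℤ[X])
    (hker : ∀ F : ℤ[X], aeval θ F = 0 ↔ g ∣ F) (p : ℕ) [Fact p.Prime]
    (hm : g.Monic)
    (hlin : ∀ q : (ZMod p)[X], Irreducible q → q ^ 2 ∣ g.map (Int.castRingHom (ZMod p)) →
      ∃ a : ZMod p, q.IsRoot a)
    (hintegral : ∀ z : B, IsIntegral ℤ z)
    (β : B) (hβ : β ∉ Algebra.adjoin ℤ ({θ} : Set B))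
    (hpβ : (p : B) * β ∈ Algebra.adjoin ℤ ({θ} : Set B)) :
    ∃ a : ℤ, (p : ℤ) ^ 2 ∣ g.eval a ∧ (p : ℤ) ∣ g.derivative.eval a := by
  set φ := Int.castRingHom (ZMod p) with hφ
  have hφs : Function.Surjective (Polynomial.mapRingHom φ) :=
    Polynomial.map_surjective _ (ZMod.ringHom_surjective _)
  have hp0 : (p : B) ≠ 0 := by exact_mod_cast (Fact.out : p.Prime).ne_zero
  have hkerφ : ∀ F : ℤ[X], F.map φ = 0 → ∃ r : ℤ[X], F = C (p : ℤ) * r := by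
    intro F hF
    have : C (p : ℤ) ∣ F := by
      rw [Polynomial.C_dvd_iff_dvd_coeff]
      intro i
      have := congrArg (fun f => f.coeff i) hF
      simp only [coeff_map, coeff_zero] at this
      exact (ZMod.intCast_zmod_eq_zero_iff_dvd _ _).mp this
    exact this
  rw [Algebra.adjoin_singleton_eq_range_aeval] at hβ hpβ
  obtain ⟨F, hF⟩ := hpβ
  replace hF : aeval θ F = p * β := hF
  let J : Ideal ℤ[X] := (Ideal.span {(p : B)}).comap (aeval θ : ℤ[X] →ₐ[ℤ] B)
  have hJ : ∀ f : ℤ[X], f ∈ J ↔ ∃ b, aeval θ f = p * b := by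
    intro f
    simp [J, Ideal.mem_comap, Ideal.mem_span_singleton, Dvd.dvd]
  let Jb := J.map (Polynomial.mapRingHom φ)
  have hJb : ∀ f : ℤ[X], f.map φ ∈ Jb → f ∈ J := by
    intro f hf
    obtain ⟨f', hf', e⟩ := (Ideal.mem_map_iff_of_surjective _ hφs).mp hf
    obtain ⟨r, hr⟩ := hkerφ (f - f') (by
      rw [Polynomial.map_sub, sub_eq_zero]; exact e.symm)
    have : f = f' + C (p : ℤ) * r := by rw [← hr]; ring
    rw [this]
    refine J.add_mem hf' ((hJ _).2 ⟨aeval θ r, by simp⟩)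
  obtain ⟨f0, hf0⟩ := (IsPrincipalIdealRing.principal Jb).principal
  have hmem : ∀ f, f ∈ Jb ↔ f0 ∣ f := by
    intro f; rw [hf0]; exact Ideal.mem_span_singleton
  have hgJ : g.map φ ∈ Jb := Ideal.mem_map_of_mem (Polynomial.mapRingHom φ) ((hJ g).2 ⟨0, by simp [(hker g).2 dvd_rfl]⟩)
  have hFJ : F.map φ ∈ Jb := Ideal.mem_map_of_mem (Polynomial.mapRingHom φ) ((hJ F).2 ⟨β, hF⟩)
  have hFg : ¬ g.map φ ∣ F.map φ := by
    rintro ⟨k, hk⟩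
    obtain ⟨k', rfl⟩ := hφs k
    obtain ⟨r, hr⟩ := hkerφ (F - g * k') (by
      rw [Polynomial.map_sub, Polynomial.map_mul, sub_eq_zero]; exact hk)
    apply hβ
    refine ⟨r, ?_⟩
    have := congrArg (aeval θ) hr
    simp only [map_sub, map_mul, (hker g).2 dvd_rfl, hF, zero_mul, sub_zero] at this
    simp at this
    rcases this with h | h
    · exact h.symm
    · exact absurd h (Fact.out : p.Prime).ne_zero
  obtain ⟨e, he⟩ := (hmem _).1 hgJ
  have hgm : (g.map φ).Monic := hm.map φ
  have hg0 : g.map φ ≠ 0 := hgm.ne_zero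
  have hf00 : f0 ≠ 0 := by rintro rfl; simp at he; exact hg0 he
  have he0 : e ≠ 0 := by rintro rfl; simp at he; exact hg0 he
  have heu : ¬ IsUnit e := by
    intro hu
    apply hFg
    rw [he]
    exact (hu.mul_right_dvd).2 ((hmem _).1 hFJ)
  obtain ⟨q, hq, hqe⟩ := WfDvdMonoid.exists_irreducible_factor heu he0
  have hnil : ∀ f : ℤ[X], f ∈ J → ∃ n, g.map φ ∣ (f.map φ) ^ n := by
    intro f hf
    obtain ⟨b, hb⟩ := (hJ f).1 hf
    obtain ⟨n, r, hr⟩ := aux_pow θ b (hintegral b) (C (p : ℤ)) f (by simpa using hb)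
    refine ⟨n, ?_⟩
    have h1 : g ∣ f ^ n - C (p : ℤ) * r := (hker _).1 (by rw [map_sub, hr, sub_self])
    have h2 := Polynomial.map_dvd φ h1
    simpa [φ] using h2
  have hqf : q ∣ f0 := by
    obtain ⟨f, hf⟩ := hφs f0
    have hf' : f.map φ = f0 := hf
    obtain ⟨n, hn⟩ := hnil f (hJb f (by rw [hf', hmem]))
    rw [hf'] at hn
    exact hq.prime.dvd_of_dvd_pow ((hqe.trans ⟨f0, by rw [he]; ring⟩).trans hn)
  obtain ⟨e', rfl⟩ := hqe
  obtain ⟨f', hf'⟩ := hqf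
  obtain ⟨ab, hab⟩ := hlin q hq ⟨f' * e', by rw [he, hf']; ring⟩
  obtain ⟨a, ha⟩ := ZMod.intCast_surjective ab
  have hXq : (X - C ab) ∣ q := dvd_iff_isRoot.2 hab
  obtain ⟨u, hu⟩ := hXq
  set h := g /ₘ (X - C a) with hh
  have hdiv : (X - C a) * h + C (g.eval a) = g := by
    have := modByMonic_add_div g (X - C a)
    rw [modByMonic_X_sub_C_eq_C_eval] at this
    rw [← hh] at this
    rw [add_comm]; exact this
  have hdvd2 : (X - C ab) * (X - C ab) ∣ g.map φ := ⟨u * u * f' * e', by rw [he, hf', hu]; ring⟩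
  have hga : (p : ℤ) ∣ g.eval a := by
    have h1 : (g.map φ).eval ab = 0 := by
      obtain ⟨k, hk⟩ := hdvd2
      rw [hk]; simp
    rw [← ha] at h1
    have h2 : ((g.eval a : ℤ) : ZMod p) = 0 := by
      rw [← h1]
      have := Polynomial.eval_map_apply (f := φ) (p := g) a
      simpa [φ] using this.symm
    exact (ZMod.intCast_zmod_eq_zero_iff_dvd _ _).mp h2
  have hga' : (p : ℤ) ∣ g.derivative.eval a := by
    have h1 : ((g.derivative).map φ).eval ab = 0 := by
      obtain ⟨k, hk⟩ := hdvd2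
      rw [← Polynomial.derivative_map, hk]; simp
    rw [← ha] at h1
    have h2 : ((g.derivative.eval a : ℤ) : ZMod p) = 0 := by
      rw [← h1]
      have := Polynomial.eval_map_apply (f := φ) (p := g.derivative) a
      simpa [φ] using this.symm
    exact (ZMod.intCast_zmod_eq_zero_iff_dvd _ _).mp h2
  have hhJ : h.map φ ∈ Jb := by
    rw [hmem]
    have h1 : (X - C ab) * h.map φ = g.map φ := by
      conv_rhs => rw [← hdiv]
      have : φ (g.eval a) = 0 := (ZMod.intCast_zmod_eq_zero_iff_dvd _ _).2 hga
      simp only [Polynomial.map_add, Polynomial.map_mul, Polynomial.map_sub, map_X, map_C, this,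
        C_0, add_zero]
      rw [← ha]; rfl
    have h2 : (X - C ab) * h.map φ = (X - C ab) * (f0 * (u * e')) := by
      rw [h1, he, hu]; ring
    exact ⟨_, mul_left_cancel₀ (X_sub_C_ne_zero ab) h2⟩
  obtain ⟨z, hz⟩ := (hJ h).1 (hJb h hhJ)
  refine ⟨a, ?_, hga'⟩
  obtain ⟨m, hmm⟩ := hga
  have hzy : aeval θ (C (-m)) = aeval θ (X - C a) * z := by
    have := congrArg (aeval θ) hdiv
    rw [map_add, map_mul, hz, (hker g).2 dvd_rfl, hmm] at this
    apply mul_left_cancel₀ hp0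
    simp at this ⊢
    linear_combination -this
  obtain ⟨n, r, hr⟩ := aux_pow θ z (hintegral z) (X - C a) (C (-m)) hzy
  have h1 : g ∣ C (-m) ^ n - (X - C a) * r := (hker _).1 (by rw [map_sub, hr, sub_self])
  have h2 := Polynomial.eval_dvd (x := a) h1
  simp at h2
  have h3 : (p : ℤ) ∣ (-m) ^ n := (Dvd.intro m hmm.symm).trans h2
  have hpp : Prime (p : ℤ) := Nat.prime_iff_prime_int.1 Fact.out
  have h4 : (p : ℤ) ∣ m := (dvd_neg).1 (hpp.dvd_of_dvd_pow h3)
  obtain ⟨m', rfl⟩ := h4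
  exact ⟨m', by rw [hmm]; ring⟩

lemma aux_int {K : Type*} [Field K] (z y : K) (p e0 e1 a2 a3 a4 : ℤ) (hp0 : (p : K) ≠ 0)
    (hpz : (p : K) * z = y ^ 4 + a4 * y ^ 3 + a3 * y ^ 2 + a2 * y + p * e1)
    (hzy : z * y = - (p * e0)) : IsIntegral ℤ z := by
  refine ⟨X ^ 5 + (C (-e1) * X ^ 4 + C (a2 * e0) * X ^ 3 + C (- (a3 * e0 ^ 2 * p)) * X ^ 2
      + C (a4 * e0 ^ 3 * p ^ 2) * X + C (- (e0 ^ 4 * p ^ 3))), ?_, ?_⟩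
  · apply monic_X_pow_add
    compute_degree!
  · have h2 : (p : K) * z ^ 5 = (z * y) ^ 4 + a4 * (z * y) ^ 3 * z + a3 * (z * y) ^ 2 * z ^ 2
        + a2 * (z * y) * z ^ 3 + p * e1 * z ^ 4 := by
      linear_combination z ^ 4 * hpz
    rw [hzy] at h2
    simp only [eval₂_add, eval₂_mul, eval₂_pow, eval₂_X, eval₂_C]
    simp only [eq_intCast]
    push_cast
    apply mul_left_cancel₀ hp0
    linear_combination h2

/-- The forward direction. -/
lemma aux_forw {K : Type*} [Field K] [NumberField K] (θ : 𝓞 K) (c d : ℤ) (g : ℤ[X])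
    (hg : g = X ^ 5 + C c * X ^ 4 + C d)
    (hker : ∀ F : ℤ[X], aeval θ F = 0 ↔ g ∣ F) (p : ℤ) (hp : Prime p) (a : ℤ)
    (h0 : p ^ 2 ∣ a ^ 5 + c * a ^ 4 + d) (h1 : p ∣ 5 * a ^ 4 + 4 * c * a ^ 3) :
    Algebra.adjoin ℤ ({θ} : Set (𝓞 K)) ≠ ⊤ := by
  intro htop
  obtain ⟨e0, he0⟩ := h0
  obtain ⟨e1, he1⟩ := h1
  set a2 : ℤ := 10 * a ^ 3 + 6 * c * a ^ 2 with ha2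
  set a3 : ℤ := 10 * a ^ 2 + 4 * c * a with ha3
  set a4 : ℤ := 5 * a + c with ha4
  set H : ℤ[X] := (X - C a) ^ 4 + C a4 * (X - C a) ^ 3 + C a3 * (X - C a) ^ 2 +
    C a2 * (X - C a) + C (p * e1) with hH
  have hp0 : (p : K) ≠ 0 := by exact_mod_cast hp.ne_zero
  have hgθ : aeval θ g = 0 := (hker g).2 dvd_rfl
  have hgθ' : (θ : K) ^ 5 + c * (θ : K) ^ 4 + d = 0 := by
    have := congrArg (fun x : 𝓞 K => (x : K)) hgθ
    simpa [hg] using this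
  have he0' : (a : K) ^ 5 + c * a ^ 4 + d = p ^ 2 * e0 := by exact_mod_cast he0
  have he1' : 5 * (a : K) ^ 4 + 4 * c * a ^ 3 = p * e1 := by exact_mod_cast he1
  set y : K := (θ : K) - a with hy
  set w : K := y ^ 4 + a4 * y ^ 3 + a3 * y ^ 2 + a2 * y + p * e1 with hw
  set z : K := w / p with hz
  have hpz : (p : K) * z = w := by rw [hz]; field_simp
  have hwy : w * y = - (p ^ 2 * e0) := by
    rw [hw, ← he0', ← he1', hy, ha2, ha3, ha4]
    push_cast
    linear_combination hgθ'
  have hzy : z * y = - (p * e0) := by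
    apply mul_left_cancel₀ hp0
    rw [← mul_assoc, hpz, hwy]; ring
  have hzint : IsIntegral ℤ z := by
    exact aux_int z y p e0 e1 a2 a3 a4 hp0 (by rw [hpz]) hzy
  let Z : 𝓞 K := ⟨z, hzint⟩
  have hZ : Z ∈ Algebra.adjoin ℤ ({θ} : Set (𝓞 K)) := by rw [htop]; trivial
  rw [Algebra.adjoin_singleton_eq_range_aeval] at hZ
  obtain ⟨r, hr⟩ := hZ
  replace hr : aeval θ r = Z := hr
  have hHr : aeval θ (H - C p * r) = 0 := by
    rw [map_sub, map_mul, hr]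
    apply RingOfIntegers.ext
    have : ((Z : 𝓞 K) : K) = z := rfl
    simp [hH, this, hpz, hw, hy]
  have hdv := (hker _).1 hHr
  haveI : Fact (Nat.Prime p.natAbs) := ⟨Int.prime_iff_natAbs_prime.1 hp⟩
  let φ := Int.castRingHom (ZMod p.natAbs)
  have hφp : φ p = 0 := (ZMod.intCast_zmod_eq_zero_iff_dvd _ _).2 (by simp)
  have h2 := Polynomial.map_dvd φ hdv
  have hφp' : (p : ZMod p.natAbs) = 0 := by simpa [φ] using hφp
  have hHd : H.natDegree ≤ 4 := by rw [hH]; compute_degree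
  have hHc : H.coeff 4 = 1 := by rw [hH]; compute_degree!
  have hgd : g.natDegree = 5 := by rw [hg]; compute_degree!
  have hgm : g.Monic := by rw [hg]; monicity!
  have h3 : (H - C p * r).map φ = H.map φ := by
    rw [Polynomial.map_sub, Polynomial.map_mul, map_C, hφp]; simp
  rw [h3] at h2
  refine (hgm.map φ).not_dvd_of_natDegree_lt ?_ ?_ h2
  · intro h
    have := congrArg (fun f => f.coeff 4) h
    simp [hHc] at this
  · rw [hgm.natDegree_map, hgd]
    exact lt_of_le_of_lt natDegree_map_le (by omega)

lemma aux_arith1 (c d : ℤ) (h : ¬ (Squarefree d ∧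
        ((5 : ℤ) ∣ c → ¬ (5 : ℤ) ∣ d →
          ¬ (c + d ≡ 1 [ZMOD 25] ∨ c + d ≡ 7 [ZMOD 25] ∨
            c + d ≡ 18 [ZMOD 25] ∨ c + d ≡ 24 [ZMOD 25])))) :
    ∃ p a : ℤ, Prime p ∧ p ^ 2 ∣ a ^ 5 + c * a ^ 4 + d ∧ p ∣ 5 * a ^ 4 + 4 * c * a ^ 3 := by
  by_cases hd : Squarefree d
  · have h' : ¬ ((5 : ℤ) ∣ c → ¬ (5 : ℤ) ∣ d →
          ¬ (c + d ≡ 1 [ZMOD 25] ∨ c + d ≡ 7 [ZMOD 25] ∨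
            c + d ≡ 18 [ZMOD 25] ∨ c + d ≡ 24 [ZMOD 25])) := fun h' => h ⟨hd, h'⟩
    push Not at h'
    obtain ⟨⟨k, rfl⟩, hd5, hc⟩ := h'
    refine ⟨5, -d, Int.prime_iff_natAbs_prime.2 (by norm_num), ?_, ?_⟩
    · have key : ∀ d k : ZMod 25, (5 * k + d = 1 ∨ 5 * k + d = 7 ∨ 5 * k + d = 18 ∨
          5 * k + d = 24) → (-d) ^ 5 + 5 * k * (-d) ^ 4 + d = 0 := by decide
      have hmod : ∀ x y : ℤ, x ≡ y [ZMOD 25] ↔ (x : ZMod 25) = y :=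
        fun x y => (ZMod.intCast_eq_intCast_iff x y 25).symm
      simp only [hmod] at hc
      push_cast at hc
      have h2 := key d k hc
      have h3 : (((-d) ^ 5 + 5 * k * (-d) ^ 4 + d : ℤ) : ZMod 25) = 0 := by exact_mod_cast h2
      exact (ZMod.intCast_zmod_eq_zero_iff_dvd _ 25).1 h3
    · exact ⟨d ^ 4 - 4 * k * d ^ 3, by ring⟩
  · rw [← Int.squarefree_natAbs, Nat.squarefree_iff_prime_squarefree] at hd
    push Not at hd
    obtain ⟨p, hp, hpd⟩ := hd
    refine ⟨p, 0, Nat.prime_iff_prime_int.1 hp, ?_, by simp⟩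
    have := Int.natCast_dvd.2 hpd
    simpa [pow_two] using this

lemma aux_arith2 (c d : ℤ) (hsf : Squarefree ((5 ^ 5 * d + 2 ^ 8 * c ^ 5) /
      (Int.gcd (5 ^ 5 * d) (2 ^ 8 * c ^ 5) : ℤ))) (h : Squarefree d ∧
        ((5 : ℤ) ∣ c → ¬ (5 : ℤ) ∣ d →
          ¬ (c + d ≡ 1 [ZMOD 25] ∨ c + d ≡ 7 [ZMOD 25] ∨
            c + d ≡ 18 [ZMOD 25] ∨ c + d ≡ 24 [ZMOD 25])))
    (p a : ℤ) (hp : Prime p) (h0 : p ^ 2 ∣ a ^ 5 + c * a ^ 4 + d)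
    (h1 : p ∣ 5 * a ^ 4 + 4 * c * a ^ 3) : False := by
  obtain ⟨hd, h5⟩ := h
  by_cases hpa : p ∣ a
  · have h2 : p ^ 2 ∣ d := by
      have : p ^ 2 ∣ a ^ 2 * (a ^ 3 + c * a ^ 2) := (pow_dvd_pow_of_dvd hpa 2).mul_right _
      have h3 := dvd_sub h0 this
      ring_nf at h3
      exact h3
    exact hp.not_isUnit (hd p (by rwa [← pow_two]))
  have h1' : p ∣ 5 * a + 4 * c := by
    have : p ∣ a ^ 3 * (5 * a + 4 * c) := by convert h1 using 1; ring
    exact (hp.dvd_or_dvd this).resolve_left (fun h => hpa (hp.dvd_of_dvd_pow h))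
  have p5 : Prime (5 : ℤ) := Int.prime_iff_natAbs_prime.2 (by norm_num)
  have p2 : Prime (2 : ℤ) := Int.prime_iff_natAbs_prime.2 (by norm_num)
  by_cases hp5 : p ∣ 5
  · have hass : Associated p 5 := (hp.dvd_prime_iff_associated p5).1 hp5
    have e5 : ∀ x, p ∣ x ↔ 5 ∣ x := fun x => hass.dvd_iff_dvd_left
    have h25 : (5 : ℤ) ^ 2 ∣ a ^ 5 + c * a ^ 4 + d := ((hass.pow_pow (n := 2)).dvd_iff_dvd_left).1 h0
    rw [e5] at hpa h1'
    have hc : (5 : ℤ) ∣ c := by omega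
    obtain ⟨k, rfl⟩ := hc
    have hd5 : ¬ (5 : ℤ) ∣ d := by
      intro h
      have h3 : (5 : ℤ) ∣ a ^ 5 := by
        have h4 : (5 : ℤ) ∣ a ^ 5 + 5 * k * a ^ 4 + d := (Dvd.intro_left (5 : ℤ) (by ring)).trans h25
        have h6 := dvd_sub h4 (dvd_add (Dvd.intro (k * a ^ 4) rfl) h)
        ring_nf at h6
        exact h6
      exact hpa (p5.dvd_of_dvd_pow h3)
    apply h5 ⟨k, rfl⟩ hd5
    have z25 : (a : ZMod 25) ^ 5 + 5 * k * a ^ 4 + d = 0 := by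
      have := (ZMod.intCast_zmod_eq_zero_iff_dvd _ 25).2 h25
      exact_mod_cast this
    have ha5 : (5 : ZMod 25) * a ≠ 0 := by
      intro h
      have : ((5 * a : ℤ) : ZMod 25) = 0 := by exact_mod_cast h
      have := (ZMod.intCast_zmod_eq_zero_iff_dvd _ 25).1 this
      omega
    have key : ∀ a k : ZMod 25, 5 * a ≠ 0 → (5 * k + -(a ^ 5 + 5 * k * a ^ 4) = 1 ∨
        5 * k + -(a ^ 5 + 5 * k * a ^ 4) = 7 ∨
        5 * k + -(a ^ 5 + 5 * k * a ^ 4) = 18 ∨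
        5 * k + -(a ^ 5 + 5 * k * a ^ 4) = 24) := by decide
    have hd' : (d : ZMod 25) = -((a : ZMod 25) ^ 5 + 5 * k * a ^ 4) := by
      linear_combination z25
    have := key a k ha5
    rw [← hd'] at this
    have hmod : ∀ x y : ℤ, x ≡ y [ZMOD 25] ↔ (x : ZMod 25) = y :=
      fun x y => (ZMod.intCast_eq_intCast_iff x y 25).symm
    simp only [hmod] 
    push_cast
    exact this
  · have hp2 : ¬ p ∣ 2 := by
      intro h
      have : p ∣ 5 * a := by
        have h3 : p ∣ 2 * (2 * c) := h.mul_right _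
        have := dvd_sub h1' h3
        ring_nf at this ⊢
        exact this
      exact (hp.dvd_or_dvd this).elim hp5 hpa
    have hpc : ¬ p ∣ c := by
      intro h
      have : p ∣ 5 * a := by
        have h3 : p ∣ c * 4 := h.mul_right _
        have := dvd_sub h1' h3
        ring_nf at this ⊢
        exact this
      exact (hp.dvd_or_dvd this).elim hp5 hpa
    have hpX : ¬ p ∣ 2 ^ 8 * c ^ 5 := by
      intro h
      rcases hp.dvd_or_dvd h with h | h
      · exact hp2 (hp.dvd_of_dvd_pow h)
      · exact hpc (hp.dvd_of_dvd_pow h)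
    have hN : p ^ 2 ∣ 5 ^ 5 * d + 2 ^ 8 * c ^ 5 := by
      obtain ⟨k, hk⟩ := h1'
      obtain ⟨m, hm⟩ := h0
      have e : ∃ s, 5 ^ 5 * (a ^ 5 + c * a ^ 4 + d) = 5 ^ 5 * d + 2 ^ 8 * c ^ 5 + (5 * a + 4 * c) ^ 2 * s := by
        refine ⟨(5*a)^3 - 3*c*(5*a)^2 + 8*c^2*(5*a) - 16 * c^3, by ring⟩
      obtain ⟨s, hs⟩ := e
      rw [hk, hm] at hs
      exact ⟨5 ^ 5 * m - k ^ 2 * s, by linear_combination -hs⟩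
    set G : ℤ := (Int.gcd (5 ^ 5 * d) (2 ^ 8 * c ^ 5) : ℤ) with hG
    have hGX : G ∣ 2 ^ 8 * c ^ 5 := Int.gcd_dvd_right _ _
    have hGN : G ∣ 5 ^ 5 * d + 2 ^ 8 * c ^ 5 := dvd_add (Int.gcd_dvd_left _ _) hGX
    have hpG : ¬ p ∣ G := fun h => hpX (h.trans hGX)
    obtain ⟨Q, hQ⟩ := hGN
    have hG0 : G ≠ 0 := by rintro h; exact hpG (h ▸ dvd_zero _)
    rw [hQ, Int.mul_ediv_cancel_left _ hG0] at hsf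
    rw [hQ] at hN
    have hco : IsCoprime (p ^ 2) G := ((hp.coprime_iff_not_dvd).2 hpG).pow_left
    have := hco.dvd_of_dvd_mul_left hN
    exact hp.not_isUnit (hsf p (by rwa [← pow_two]))

lemma aux_lin (c d : ℤ) (g : ℤ[X]) (hg : g = X ^ 5 + C c * X ^ 4 + C d) (p : ℕ) [Fact p.Prime]
    (q : (ZMod p)[X]) (hq : Irreducible q) (hq2 : q ^ 2 ∣ g.map (Int.castRingHom (ZMod p))) :
    ∃ a : ZMod p, q.IsRoot a := by
  have hgm : g.map (Int.castRingHom (ZMod p)) = X ^ 5 + C (c : ZMod p) * X ^ 4 + C (d : ZMod p) := by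
    simp [hg]
  rw [hgm] at hq2
  have hroot : ∀ b : ZMod p, q ∣ X - C b → ∃ a, q.IsRoot a := by
    intro b hb
    have := (hq.associated_of_dvd (irreducible_X_sub_C b) hb)
    exact ⟨b, dvd_iff_isRoot.1 this.symm.dvd⟩
  have hder : q ∣ C (5 : ZMod p) * X ^ 4 + C (c : ZMod p) * (C 4 * X ^ 3) := by
    obtain ⟨k, hk⟩ := hq2
    have := congrArg derivative hk
    refine ⟨2 * derivative q * k + q * derivative k, ?_⟩
    have hC2 : (C (2 : ZMod p) : (ZMod p)[X]) = 2 := rfl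
    simp [derivative_pow] at this
    simp
    rw [hC2] at this
    linear_combination this
  have hder2 : q ∣ X ^ 3 * (C (5 : ZMod p) * X + C (4 * c : ZMod p)) := by
    convert hder using 1
    simp
    ring
  rcases hq.prime.dvd_or_dvd hder2 with h | h
  · exact hroot 0 (by simpa using hq.prime.dvd_of_dvd_pow h)
  · by_cases h5 : (5 : ZMod p) = 0
    · have hp5 : p = 5 := by
        have : ((5 : ℕ) : ZMod p) = 0 := by exact_mod_cast h5
        rw [ZMod.natCast_eq_zero_iff] at this
        exact (Nat.prime_dvd_prime_iff_eq Fact.out (by norm_num)).1 this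
      by_cases hc : (c : ZMod p) = 0
      · subst hp5
        refine hroot (-d) ?_
        have : q ∣ (X - C (-(d : ZMod 5))) ^ 5 := by
          rw [sub_pow_char]
          have h2 : q ∣ q ^ 2 := dvd_pow_self _ (by norm_num)
          convert h2.trans hq2 using 1
          rw [← C_pow, neg_pow, ZMod.pow_card, hc]
          simp
        exact hq.prime.dvd_of_dvd_pow this
      · exfalso
        rw [h5] at h
        simp only [C_0, zero_mul, zero_add] at h
        have h4 : (4 : ZMod p) ≠ 0 := by
          have : ∀ n : ℕ, n = 5 → (4 : ZMod n) ≠ 0 := by rintro n rfl; decide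
          exact this p hp5
        exact hq.not_isUnit (isUnit_of_dvd_unit h
          (Polynomial.isUnit_C.2 (isUnit_iff_ne_zero.2 (mul_ne_zero h4 hc))))
    · refine hroot (-(4 * c) / 5) ?_
      have : C (5 : ZMod p) * X + C (4 * c : ZMod p) = C (5 : ZMod p) * (X - C (-(4 * (c : ZMod p)) / 5)) := by
        rw [mul_sub, ← C_mul, mul_div_cancel₀ _ h5]; simp
      rw [this] at h
      rcases hq.prime.dvd_or_dvd h with h | h
      · exact absurd (isUnit_of_dvd_unit h (Polynomial.isUnit_C.2 (isUnit_iff_ne_zero.2 h5))) hq.not_isUnit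
      · exact h

theorem stmt12 (c d : ℤ)
    (g : ℤ[X]) (hg : g = X ^ 5 + C c * X ^ 4 + C d)
    (hirr : Irreducible (g.map (Int.castRingHom ℚ)))
    (hsf : Squarefree ((5 ^ 5 * d + 2 ^ 8 * c ^ 5) /
      (Int.gcd (5 ^ 5 * d) (2 ^ 8 * c ^ 5) : ℤ)))
    (K : Type*) [Field K] [NumberField K] (θ : NumberField.RingOfIntegers K)
    (hroot : Polynomial.aeval θ g = 0)
    (hgen : Algebra.adjoin ℚ ({(θ : K)} : Set K) = ⊤) :
    Algebra.adjoin ℤ ({θ} : Set (NumberField.RingOfIntegers K)) = ⊤ ↔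
      (Squarefree d ∧
        ((5 : ℤ) ∣ c → ¬ (5 : ℤ) ∣ d →
          ¬ (c + d ≡ 1 [ZMOD 25] ∨ c + d ≡ 7 [ZMOD 25] ∨
            c + d ≡ 18 [ZMOD 25] ∨ c + d ≡ 24 [ZMOD 25]))) := by
  have hgm : g.Monic := by rw [hg]; monicity!
  have hKaev : ∀ F : ℤ[X], ((aeval θ F : 𝓞 K) : K) = aeval (θ : K) (F.map (Int.castRingHom ℚ)) := by
    intro F
    have h1 : aeval (θ : K) (F.map (algebraMap ℤ ℚ)) = aeval (θ : K) F := aeval_map_algebraMap ℚ (θ : K) F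
    have h2 : aeval (algebraMap (𝓞 K) K θ) F = algebraMap (𝓞 K) K (aeval θ F) :=
      aeval_algebraMap_apply K θ F
    exact h2.symm.trans h1.symm
  have hker : ∀ F : ℤ[X], aeval θ F = 0 ↔ g ∣ F := by
    intro F
    constructor
    · intro hF
      have h1 := hKaev F
      have h2 := hKaev g
      rw [hF] at h1
      rw [hroot] at h2
      have hmin : g.map (Int.castRingHom ℚ) = minpoly ℚ (θ : K) :=
        minpoly.eq_of_irreducible_of_monic hirr (by rw [← h2]; rfl) (hgm.map _)
      have h3 : g.map (Int.castRingHom ℚ) ∣ F.map (Int.castRingHom ℚ) := by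
        rw [hmin]; exact minpoly.dvd _ _ (by rw [← h1]; rfl)
      exact (Polynomial.map_dvd_map _ (Int.cast_injective) hgm).1 h3
    · rintro ⟨k, rfl⟩
      rw [map_mul, hroot, zero_mul]
  constructor
  · intro htop
    by_contra hcon
    obtain ⟨p, a, hp, h0, h1⟩ := aux_arith1 c d hcon
    exact aux_forw θ c d g hg hker p hp a h0 h1 htop
  · intro hR
    by_contra hne
    have hex : ∃ α : 𝓞 K, α ∉ Algebra.adjoin ℤ ({θ} : Set (𝓞 K)) := by
      by_contra! h
      exact hne (eq_top_iff.2 fun x _ => h x)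
    obtain ⟨α, hα⟩ := hex
    have hmul : ∃ n : ℕ, 0 < n ∧ (n : 𝓞 K) * α ∈ Algebra.adjoin ℤ ({θ} : Set (𝓞 K)) := by
      have h1 : (α : K) ∈ Algebra.adjoin ℚ ({(θ : K)} : Set K) := by rw [hgen]; trivial
      rw [Algebra.adjoin_singleton_eq_range_aeval] at h1
      obtain ⟨P, hP⟩ := h1
      replace hP : aeval (θ : K) P = α := hP
      obtain ⟨b, hbM, hb⟩ := IsLocalization.integerNormalization_spec (nonZeroDivisors ℤ) P
      have hb0 : (b : ℤ) ≠ 0 := nonZeroDivisors.ne_zero hbM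
      set R := IsLocalization.integerNormalization (nonZeroDivisors ℤ) P
      have h2 : aeval θ R = ((b : ℤ) : 𝓞 K) * α := by
        apply RingOfIntegers.ext
        rw [hKaev]
        have h3 : R.map (Int.castRingHom ℚ) = (b : ℤ) • P := hb
        rw [h3, map_zsmul, hP]
        simp
      have h4 : ((b : ℤ) : 𝓞 K) * α ∈ Algebra.adjoin ℤ ({θ} : Set (𝓞 K)) := by
        rw [← h2, Algebra.adjoin_singleton_eq_range_aeval]
        exact ⟨R, rfl⟩
      refine ⟨(b : ℤ).natAbs, Int.natAbs_pos.2 hb0, ?_⟩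
      rcases Int.natAbs_eq (b : ℤ) with h | h
      · rw [h, Int.cast_natCast] at h4
        exact h4
      · rw [h, Int.cast_neg, Int.cast_natCast] at h4
        have := neg_mem h4
        rwa [neg_mul, neg_neg] at this
    classical
    have hspec := Nat.find_spec hmul
    set n := Nat.find hmul with hn
    have hn1 : n ≠ 1 := by
      intro h
      rw [h] at hspec
      exact hα (by simpa using hspec.2)
    obtain ⟨p, hp, m, hm⟩ := Nat.exists_prime_and_dvd hn1
    haveI : Fact p.Prime := ⟨hp⟩
    have hm0 : 0 < m := by
      rcases Nat.eq_zero_or_pos m with h | h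
      · rw [h] at hm; omega
      · exact h
    have hlt : m < n := by rw [hm]; nlinarith [hp.two_le]
    have hmα : (m : 𝓞 K) * α ∉ Algebra.adjoin ℤ ({θ} : Set (𝓞 K)) := fun h =>
      Nat.find_min hmul hlt ⟨hm0, h⟩
    obtain ⟨a, h0, h1⟩ := aux_back θ g hker p hgm (fun q hq h => aux_lin c d g hg p q hq h)
      (fun z => RingOfIntegers.isIntegral z) ((m : 𝓞 K) * α) hmα (by
        have := hspec.2
        rw [hm] at this
        push_cast at this
        rwa [← mul_assoc])
    refine aux_arith2 c d hsf hR p a (Nat.prime_iff_prime_int.1 hp) ?_ ?_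
    · simpa [hg] using h0
    · have e : g.derivative.eval a = 5 * a ^ 4 + 4 * c * a ^ 3 := by
        simp [hg]; ring
      rwa [e] at h1
end

section
/- Let g(x) = x^5 + c x^4 + d ∈ ℤ[x] be irreducible with 5 | c and 5 ∤ d, and let θ be a root. Then 5 divides the index [O_{ℚ(θ)} : ℤ[θ]] if and only if 25 divides c d^4 + d − d^5, which holds if and only if c + d ≡ 1, 7, 18, or 24 (mod 25). -/
open Polynomial NumberField

lemma mem_adj_iff {K : Type*} [Field K] [NumberField K] (θ x : NumberField.RingOfIntegers K) :
    x ∈ Algebra.adjoin ℤ ({θ} : Set (NumberField.RingOfIntegers K)) ↔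
      (x : K) ∈ Algebra.adjoin ℤ ({(θ : K)} : Set K) := by
  have h : Algebra.adjoin ℤ ({(θ : K)} : Set K) =
      (Algebra.adjoin ℤ ({θ} : Set (NumberField.RingOfIntegers K))).map
        (IsScalarTower.toAlgHom ℤ (NumberField.RingOfIntegers K) K) := by
    rw [AlgHom.map_adjoin]; simp
  rw [h, Subalgebra.mem_map]
  constructor
  · intro hx
    exact ⟨x, hx, rfl⟩
  · rintro ⟨y, hy, hyx⟩
    have : y = x := RingOfIntegers.ext hyx
    exact this ▸ hy

/-- Monic quintic with given coefficients. -/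
noncomputable def quintic (a4 a3 a2 a1 a0 : ℤ) : ℤ[X] :=
  X ^ 5 + C a4 * X ^ 4 + C a3 * X ^ 3 + C a2 * X ^ 2 + C a1 * X + C a0

lemma aeval_quintic {K : Type*} [Field K] (a4 a3 a2 a1 a0 : ℤ) (x : K) :
    aeval x (quintic a4 a3 a2 a1 a0) =
      x ^ 5 + a4 * x ^ 4 + a3 * x ^ 3 + a2 * x ^ 2 + a1 * x + a0 := by
  simp [quintic]

lemma coeff_quintic (a4 a3 a2 a1 a0 : ℤ) (n : ℕ) (hn : n < 5) :
    (quintic a4 a3 a2 a1 a0).coeff n = ![a0, a1, a2, a3, a4] ⟨n, hn⟩ := by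
  simp only [quintic, coeff_add, coeff_C_mul, coeff_X_pow, coeff_X, coeff_C]
  interval_cases n <;> simp

lemma quintic_natDegree (a4 a3 a2 a1 a0 : ℤ) : (quintic a4 a3 a2 a1 a0).natDegree = 5 := by
  unfold quintic; compute_degree!

lemma quintic_monic (a4 a3 a2 a1 a0 : ℤ) : (quintic a4 a3 a2 a1 a0).Monic := by
  unfold quintic; monicity!

/-- Monic quartic with given coefficients. -/
noncomputable def quartic (a4 a3 a2 a1 : ℤ) : ℤ[X] :=
  X ^ 4 + C a4 * X ^ 3 + C a3 * X ^ 2 + C a2 * X + C a1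

lemma aeval_quartic {K : Type*} [Field K] (a4 a3 a2 a1 : ℤ) (x : K) :
    aeval x (quartic a4 a3 a2 a1) =
      x ^ 4 + a4 * x ^ 3 + a3 * x ^ 2 + a2 * x + a1 := by
  simp [quartic]

/-- The Taylor shift of `g` at `-d`. -/
noncomputable def shiftPoly (c d : ℤ) : ℤ[X] :=
  quintic (c - 5 * d) (10 * d ^ 2 - 4 * c * d) (6 * c * d ^ 2 - 10 * d ^ 3)
    (5 * d ^ 4 - 4 * c * d ^ 3) (c * d ^ 4 + d - d ^ 5)

/-- The quotient of the shifted polynomial by `X`, without constant term. -/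
noncomputable def quotPoly (c d : ℤ) : ℤ[X] :=
  quartic (c - 5 * d) (10 * d ^ 2 - 4 * c * d) (6 * c * d ^ 2 - 10 * d ^ 3)
    (5 * d ^ 4 - 4 * c * d ^ 3)

lemma shiftPoly_natDegree (c d : ℤ) : (shiftPoly c d).natDegree = 5 := by
  exact quintic_natDegree _ _ _ _ _

lemma shiftPoly_monic (c d : ℤ) : (shiftPoly c d).Monic := by
  exact quintic_monic _ _ _ _ _

lemma quotPoly_natDegree (c d : ℤ) : (quotPoly c d).natDegree = 4 := by
  unfold quotPoly quartic; compute_degree!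

lemma quotPoly_monic (c d : ℤ) : (quotPoly c d).Monic := by
  unfold quotPoly quartic; monicity!

lemma minpoly_shift (c d : ℤ) 
    (g : ℤ[X]) (hg : g = X ^ 5 + C c * X ^ 4 + C d)
    (hirr : Irreducible (g.map (Int.castRingHom ℚ)))
    (K : Type*) [Field K] [NumberField K] (t : K) (hInt : IsIntegral ℤ t)
    (hroot : Polynomial.aeval t g = 0) :
    minpoly ℤ (t + (d : K)) = shiftPoly c d := by
  have hm : g.Monic := by rw [hg]; monicity!
  have h1 : minpoly ℚ t = g.map (Int.castRingHom ℚ) := by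
    symm
    apply minpoly.eq_of_irreducible_of_monic hirr
    · rw [show Int.castRingHom ℚ = algebraMap ℤ ℚ from rfl, aeval_map_algebraMap]; exact hroot
    · exact hm.map _
  have h3 := minpoly.add_algebraMap (A := ℚ) t (d : ℚ)
  have h4 : algebraMap ℚ K (d : ℚ) = (d : K) := by simp
  rw [h4] at h3
  have hInt' : IsIntegral ℤ (t + (d : K)) := hInt.add (isIntegral_algebraMap (x := d))
  apply Polynomial.map_injective (Int.castRingHom ℚ) Int.cast_injective
  have h5 := (minpoly.isIntegrallyClosed_eq_field_fractions' ℚ hInt').symm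
  rw [show Int.castRingHom ℚ = algebraMap ℤ ℚ from rfl, h5, h3, h1, hg, shiftPoly, quintic]
  simp only [Polynomial.map_add, Polynomial.map_mul, Polynomial.map_pow, map_X, add_comp,
    mul_comp, pow_comp, X_comp, eq_intCast, Int.cast_add, Int.cast_sub, Int.cast_mul,
    Int.cast_pow, Int.cast_ofNat, map_intCast, intCast_comp, Polynomial.map_intCast,
    Polynomial.map_sub, Polynomial.map_ofNat]
  ring

lemma adjoin_shift {R K : Type*} [CommRing R] [Field K] [Algebra R K] (t : K) (d : ℤ) :
    Algebra.adjoin R ({t + (d : K)} : Set K) = Algebra.adjoin R ({t} : Set K) := by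
  have hd : ∀ S : Subalgebra R K, (d : K) ∈ S := fun S => intCast_mem S d
  apply le_antisymm
  · apply Algebra.adjoin_le
    rw [Set.singleton_subset_iff]
    exact add_mem (Algebra.self_mem_adjoin_singleton R t) (hd _)
  · apply Algebra.adjoin_le
    rw [Set.singleton_subset_iff]
    have := sub_mem (Algebra.self_mem_adjoin_singleton R (t + (d : K))) (hd _)
    simpa using this

lemma exists_mul_mem_s13 {K : Type*} [Field K] [NumberField K] (t : K)
    (hgen : Algebra.adjoin ℚ ({t} : Set K) = ⊤) (x : K) :
    ∃ n : ℤ, n ≠ 0 ∧ (n : K) * x ∈ Algebra.adjoin ℤ ({t} : Set K) := by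
  have hx : x ∈ Algebra.adjoin ℚ ({t} : Set K) := hgen ▸ Algebra.mem_top
  induction hx using Algebra.adjoin_induction with
  | mem y hy =>
    obtain rfl : y = t := hy
    exact ⟨1, one_ne_zero, by simp⟩
  | algebraMap r =>
    refine ⟨r.den, by exact_mod_cast r.den_nz, ?_⟩
    have : (((r.den : ℤ) : K)) * algebraMap ℚ K r = ((r.num : ℤ) : K) := by
      have h : (r.den : ℚ) * r = r.num := Rat.den_mul_eq_num r
      have h2 := congrArg (algebraMap ℚ K) h
      rw [map_mul, map_natCast, map_intCast] at h2
      rw [Int.cast_natCast]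
      exact h2
    rw [this]
    exact intCast_mem _ _
  | add y z _ _ h1 h2 =>
    obtain ⟨n, hn, h1⟩ := h1
    obtain ⟨m, hm, h2⟩ := h2
    refine ⟨n * m, mul_ne_zero hn hm, ?_⟩
    have := add_mem (mul_mem (intCast_mem (Algebra.adjoin ℤ ({t} : Set K)) m) h1)
      (mul_mem (intCast_mem (Algebra.adjoin ℤ ({t} : Set K)) n) h2)
    convert this using 1
    push_cast; ring
  | mul y z _ _ h1 h2 =>
    obtain ⟨n, hn, h1⟩ := h1
    obtain ⟨m, hm, h2⟩ := h2
    refine ⟨n * m, mul_ne_zero hn hm, ?_⟩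
    have := mul_mem h1 h2
    convert this using 1
    push_cast; ring

lemma index_dvd_iff {K : Type*} [Field K] [NumberField K] (θ : NumberField.RingOfIntegers K)
    (hgen : Algebra.adjoin ℚ ({(θ : K)} : Set K) = ⊤) :
    5 ∣ indexZTheta θ ↔ ∃ x : NumberField.RingOfIntegers K,
      5 * (x : K) ∈ Algebra.adjoin ℤ ({(θ : K)} : Set K) ∧
      (x : K) ∉ Algebra.adjoin ℤ ({(θ : K)} : Set K) := by
  unfold indexZTheta
  set S := Algebra.adjoin ℤ ({θ} : Set (NumberField.RingOfIntegers K)) with hS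
  set H := S.toSubring.toAddSubgroup with hH
  have hmem : ∀ x, x ∈ H ↔ (x : K) ∈ Algebra.adjoin ℤ ({(θ : K)} : Set K) := fun x =>
    mem_adj_iff θ x
  have hfin : Finite (NumberField.RingOfIntegers K ⧸ H) := by
    have : Module.Finite ℤ (NumberField.RingOfIntegers K ⧸ H) :=
      Module.Finite.of_surjective (QuotientAddGroup.mk' H).toIntLinearMap
        (QuotientAddGroup.mk'_surjective H)
    apply Module.finite_of_fg_torsion
    intro q
    obtain ⟨x, rfl⟩ := QuotientAddGroup.mk'_surjective H q
    obtain ⟨n, hn, hx⟩ := exists_mul_mem_s13 (θ : K) hgen (x : K)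
    refine ⟨⟨n, mem_nonZeroDivisors_of_ne_zero hn⟩, ?_⟩
    change n • (QuotientAddGroup.mk' H x) = 0
    rw [← map_zsmul, QuotientAddGroup.mk'_apply, QuotientAddGroup.eq_zero_iff, hmem]
    simpa using hx
  have h5 : ∀ x : NumberField.RingOfIntegers K, 5 • (QuotientAddGroup.mk' H x) = 0 ↔
      5 * (x : K) ∈ Algebra.adjoin ℤ ({(θ : K)} : Set K) := by
    intro x
    rw [← map_nsmul, QuotientAddGroup.mk'_apply, QuotientAddGroup.eq_zero_iff, hmem]
    have : ((5 • x : NumberField.RingOfIntegers K) : K) = 5 * (x : K) := by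
      change algebraMap (NumberField.RingOfIntegers K) K (5 • x) = _
      rw [map_nsmul, nsmul_eq_mul, Nat.cast_ofNat]
    rw [this]
  have h0 : ∀ x : NumberField.RingOfIntegers K, (QuotientAddGroup.mk' H x) = 0 ↔
      (x : K) ∈ Algebra.adjoin ℤ ({(θ : K)} : Set K) := by
    intro x
    rw [QuotientAddGroup.mk'_apply, QuotientAddGroup.eq_zero_iff, hmem]
  have : Fact (Nat.Prime 5) := ⟨by norm_num⟩
  rw [AddSubgroup.index]
  constructor
  · intro h
    obtain ⟨q, hq⟩ := exists_prime_addOrderOf_dvd_card' 5 h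
    obtain ⟨x, rfl⟩ := QuotientAddGroup.mk'_surjective H q
    refine ⟨x, (h5 x).1 ?_, fun hx => ?_⟩
    · rw [← hq]; exact addOrderOf_nsmul_eq_zero _
    · rw [(h0 x).2 hx] at hq
      simp at hq
  · rintro ⟨x, hx, hx'⟩
    have := addOrderOf_eq_prime ((h5 x).2 hx) (fun h => hx' ((h0 x).1 h))
    rw [← this]
    exact addOrderOf_dvd_natCard _

lemma pow5 (d : ℤ) : (5 : ℤ) ∣ d - d ^ 5 := by
  have : ((d - d ^ 5 : ℤ) : ZMod 5) = 0 := by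
    push_cast
    generalize (d : ZMod 5) = x
    revert x; decide
  exact (ZMod.intCast_zmod_eq_zero_iff_dvd _ 5).1 this

lemma arith (c d : ℤ) (hc : (5 : ℤ) ∣ c) (hd : ¬ (5 : ℤ) ∣ d) :
    ((25 : ℤ) ∣ (c * d ^ 4 + d - d ^ 5) ↔
        (c + d ≡ 1 [ZMOD 25] ∨ c + d ≡ 7 [ZMOD 25] ∨
          c + d ≡ 18 [ZMOD 25] ∨ c + d ≡ 24 [ZMOD 25])) := by
  obtain ⟨e, rfl⟩ := hc
  have hd' : (d : ZMod 25) ∈ ({0,5,10,15,20} : Finset (ZMod 25))ᶜ := by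
    have key : ∀ x : ZMod 25, x ∉ ({0,5,10,15,20} : Finset (ZMod 25))ᶜ → 5 * x = 0 := by decide
    by_contra h
    apply hd
    have h2 := key _ h
    have : ((5 * d : ℤ) : ZMod 25) = 0 := by push_cast; exact h2
    have := (ZMod.intCast_zmod_eq_zero_iff_dvd _ 25).1 this
    push_cast at this
    omega
  have e1 := ZMod.intCast_zmod_eq_zero_iff_dvd (5 * e * d ^ 4 + d - d ^ 5) 25
  have e2 : ∀ k : ℤ, (5 * e + d ≡ k [ZMOD 25] ↔ ((5 * e + d : ℤ) : ZMod 25) = (k : ZMod 25)) :=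
    fun k => (ZMod.intCast_eq_intCast_iff _ _ 25).symm
  push_cast at e1
  rw [← e1, e2, e2, e2, e2]
  push_cast
  revert hd'
  generalize (d : ZMod 25) = x
  generalize (e : ZMod 25) = y
  revert x y
  decide +kernel

lemma not_dvd_case (c d : ℤ) (hc : (5 : ℤ) ∣ c)
    (hn : ¬ (25 : ℤ) ∣ (c * d ^ 4 + d - d ^ 5))
    {K : Type*} [Field K] [NumberField K] (a : K) (hInt : IsIntegral ℤ a)
    (hmin : minpoly ℤ a = shiftPoly c d) (hgen : Algebra.adjoin ℚ ({a} : Set K) = ⊤)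
    (z : K) (hz : IsIntegral ℤ z) (h5 : 5 * z ∈ Algebra.adjoin ℤ ({a} : Set K)) :
    z ∈ Algebra.adjoin ℤ ({a} : Set K) := by
  let B : PowerBasis ℚ K := PowerBasis.ofAdjoinEqTop (hInt.tower_top) hgen
  have hB : B.gen = a := PowerBasis.ofAdjoinEqTop_gen _ _
  rw [← hB] at hInt hmin h5 ⊢
  have hp : Prime (5 : ℤ) := by norm_num
  refine mem_adjoin_of_smul_prime_smul_of_minpoly_isEisensteinAt (p := (5 : ℤ)) hp hInt hz ?_ ?_
  · simpa using h5
  · rw [hmin]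
    obtain ⟨e, rfl⟩ := hc
    obtain ⟨f, hf⟩ := pow5 d
    refine ⟨?_, ?_, ?_⟩
    · rw [(shiftPoly_monic _ _).leadingCoeff, Ideal.mem_span_singleton]; norm_num
    · intro n hn
      rw [shiftPoly_natDegree] at hn
      rw [Ideal.mem_span_singleton]
      rw [shiftPoly, coeff_quintic _ _ _ _ _ n hn]
      interval_cases n
      · change (5 : ℤ) ∣ 5 * e * d ^ 4 + d - d ^ 5
        exact ⟨e * d ^ 4 + f, by linear_combination hf⟩
      · change (5 : ℤ) ∣ 5 * d ^ 4 - 4 * (5 * e) * d ^ 3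
        exact ⟨d ^ 4 - 4 * e * d ^ 3, by ring⟩
      · change (5 : ℤ) ∣ 6 * (5 * e) * d ^ 2 - 10 * d ^ 3
        exact ⟨6 * e * d ^ 2 - 2 * d ^ 3, by ring⟩
      · change (5 : ℤ) ∣ 10 * d ^ 2 - 4 * (5 * e) * d
        exact ⟨2 * d ^ 2 - 4 * e * d, by ring⟩
      · change (5 : ℤ) ∣ 5 * e - 5 * d
        exact ⟨e - d, by ring⟩
    · rw [Ideal.span_singleton_pow, Ideal.mem_span_singleton]
      rw [shiftPoly, coeff_quintic _ _ _ _ _ 0 (by norm_num)]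
      simpa using hn

lemma dvd_case (c d : ℤ) (hc : (5 : ℤ) ∣ c)
    (hn : (25 : ℤ) ∣ (c * d ^ 4 + d - d ^ 5))
    {K : Type*} [Field K] [NumberField K] (a : K) (hInt : IsIntegral ℤ a)
    (hmin : minpoly ℤ a = shiftPoly c d) :
    ∃ z : K, IsIntegral ℤ z ∧ 5 * z ∈ Algebra.adjoin ℤ ({a} : Set K) ∧
    z ∉ Algebra.adjoin ℤ ({a} : Set K) := by
  have hq : aeval a (quotPoly c d) ∈ Algebra.adjoin ℤ ({a} : Set K) :=
    aeval_mem_adjoin_singleton ℤ a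
  have h5 : (5 : K) ≠ 0 := by norm_num
  obtain ⟨m, hm⟩ := hn
  obtain ⟨e, rfl⟩ := hc
  have hroot : aeval a (shiftPoly (5 * e) d) = 0 := hmin ▸ minpoly.aeval ℤ a
  refine ⟨aeval a (quotPoly (5 * e) d) / 5, ?_, ?_, ?_⟩
  · generalize hb : aeval a (quotPoly (5 * e) d) / 5 = b
    rw [div_eq_iff h5, quotPoly, aeval_quartic] at hb
    rw [shiftPoly, hm, aeval_quintic] at hroot
    push_cast at hb hroot
    refine ⟨quintic (-(d ^ 4 - 4 * e * d ^ 3)) ((6 * (5 * e) * d ^ 2 - 10 * d ^ 3) * m)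
      (-((10 * d ^ 2 - 4 * (5 * e) * d) * 5 * m ^ 2)) ((5 * e - 5 * d) * 25 * m ^ 3)
      (-(125 * m ^ 4)), quintic_monic _ _ _ _ _, ?_⟩
    change aeval b _ = 0
    rw [aeval_quintic]
    push_cast
    have hm' : (m : K) = - (a * b) / 5 := by
      field_simp
      have : a * (b * 5) + 25 * m = 0 := by
        rw [← hb]; linear_combination hroot
      linear_combination (1 / 5) * this
    rw [hm']
    linear_combination (-b ^ 4 / 5) * hb
  · convert hq using 1; field_simp
  · intro hmem
    rw [Algebra.adjoin_singleton_eq_range_aeval] at hmem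
    obtain ⟨p, hp⟩ := hmem
    have hp' : aeval a p = aeval a (quotPoly (5 * e) d) / 5 := hp
    have h0 : aeval a (quotPoly (5 * e) d - C 5 * p) = 0 := by
      rw [map_sub, map_mul, aeval_C, hp', eq_intCast]
      push_cast
      field_simp
      ring
    have hdv := minpoly.isIntegrallyClosed_dvd hInt h0
    rw [hmin] at hdv
    have : Fact (Nat.Prime 5) := ⟨by norm_num⟩
    have hdv2 := Polynomial.map_dvd (Int.castRingHom (ZMod 5)) hdv
    have h50 : (Int.castRingHom (ZMod 5)) 5 = 0 := by
      rw [eq_intCast]; rfl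
    rw [Polynomial.map_sub, Polynomial.map_mul, map_C, h50, C_0, zero_mul, sub_zero] at hdv2
    have := natDegree_le_of_dvd hdv2 ((quotPoly_monic _ _).map _).ne_zero
    rw [(quotPoly_monic _ _).natDegree_map, (shiftPoly_monic _ _).natDegree_map,
      shiftPoly_natDegree, quotPoly_natDegree] at this
    omega

theorem stmt13 (c d : ℤ) (hc : (5 : ℤ) ∣ c) (hd : ¬ (5 : ℤ) ∣ d)
    (g : ℤ[X]) (hg : g = X ^ 5 + C c * X ^ 4 + C d)
    (hirr : Irreducible (g.map (Int.castRingHom ℚ)))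
    (K : Type*) [Field K] [NumberField K] (θ : NumberField.RingOfIntegers K)
    (hroot : Polynomial.aeval θ g = 0)
    (hgen : Algebra.adjoin ℚ ({(θ : K)} : Set K) = ⊤) :
    (5 ∣ indexZTheta θ ↔ (25 : ℤ) ∣ (c * d ^ 4 + d - d ^ 5)) ∧
      ((25 : ℤ) ∣ (c * d ^ 4 + d - d ^ 5) ↔
        (c + d ≡ 1 [ZMOD 25] ∨ c + d ≡ 7 [ZMOD 25] ∨
          c + d ≡ 18 [ZMOD 25] ∨ c + d ≡ 24 [ZMOD 25])) := by
  refine ⟨?_, arith c d hc hd⟩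
  rw [index_dvd_iff θ hgen]
  have hInt : IsIntegral ℤ (θ : K) := θ.isIntegral_coe
  have hInt' : IsIntegral ℤ ((θ : K) + (d : K)) := hInt.add (isIntegral_algebraMap (x := d))
  have hroot' : aeval (θ : K) g = 0 := by
    have := congrArg (algebraMap (NumberField.RingOfIntegers K) K) hroot
    rw [← aeval_algebraMap_apply] at this
    simpa using this
  have hmin := minpoly_shift c d g hg hirr K (θ : K) hInt hroot'
  rw [← adjoin_shift (R := ℤ) (θ : K) d]
  rw [← adjoin_shift (R := ℚ) (θ : K) d] at hgen
  constructor
  · rintro ⟨x, hx, hx'⟩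
    by_contra hn
    exact hx' (not_dvd_case c d hc hn _ hInt' hmin hgen _ x.isIntegral_coe hx)
  · intro hn
    obtain ⟨z, hz, h1, h2⟩ := dvd_case c d hc hn _ hInt' hmin
    exact ⟨⟨z, hz⟩, h1, h2⟩
end

section
/- Let g(x) = x^6 + c x^5 + d ∈ ℤ[x] be irreducible with 2 | c and 2 ∤ d, and let θ be a root. Then 2 does not divide the index [O_{ℚ(θ)} : ℤ[θ]] if and only if c + d ≡ 1 (mod 4), equivalently (c mod 4, d mod 4) ∈ {(0,1),(2,3)}. -/
open Polynomial NumberField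

section Helpers

/-- Homogenised integral equation: if `P(θ) = Q(θ) γ` with `γ` integral and `t ∣ Q`, `t ∣ g` mod 2,
with `t` squarefree, then `t ∣ P` mod 2. -/
lemma dvd_of_eq_mul_integral {O : Type*} [CommRing O] (θ : O) (g : ℤ[X])
    (hdvd : ∀ P : ℤ[X], aeval θ P = 0 → g ∣ P)
    (t : (ZMod 2)[X]) (ht : Squarefree t)
    (hgt : t ∣ g.map (Int.castRingHom (ZMod 2)))
    (P Q : ℤ[X]) (γ : O) (hγ : IsIntegral ℤ γ)
    (h : aeval θ P = aeval θ Q * γ) (hQ : t ∣ Q.map (Int.castRingHom (ZMod 2))) :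
    t ∣ P.map (Int.castRingHom (ZMod 2)) := by
  obtain ⟨m, hm, hm0⟩ := hγ
  let f : ℤ[X] →+* O := (aeval θ : ℤ[X] →ₐ[ℤ] O).toRingHom
  have h1 : eval₂ f γ (m.map (C : ℤ →+* ℤ[X])) = 0 := by
    rw [eval₂_map]
    rw [show f.comp (C : ℤ →+* ℤ[X]) = algebraMap ℤ O from RingHom.ext_int _ _]
    exact hm0
  have h2 := scaleRoots_eval₂_eq_zero (s := Q) f h1
  have h3 : f Q * γ = f P := h.symm
  rw [h3, eval₂_at_apply] at h2
  have h4 := hdvd _ h2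
  let φ : ℤ[X] →+* (ZMod 2)[X] := mapRingHom (Int.castRingHom (ZMod 2))
  have h5 : t ∣ φ (eval P (scaleRoots (m.map (C : ℤ →+* ℤ[X])) Q)) :=
    hgt.trans (map_dvd φ h4)
  have hmon : (scaleRoots (m.map (C : ℤ →+* ℤ[X])) Q).Monic :=
    (monic_scaleRoots_iff _).2 (hm.map _)
  rw [eval_eq_sum_range, map_sum, Finset.sum_range_succ, hmon.coeff_natDegree] at h5
  have h6 : t ∣ ∑ i ∈ Finset.range (scaleRoots (m.map (C : ℤ →+* ℤ[X])) Q).natDegree,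
      φ ((scaleRoots (m.map (C : ℤ →+* ℤ[X])) Q).coeff i * P ^ i) := by
    refine Finset.dvd_sum fun i hi => ?_
    rw [Finset.mem_range, natDegree_scaleRoots] at hi
    rw [coeff_scaleRoots, map_mul, map_mul, map_pow]
    refine Dvd.dvd.mul_right (Dvd.dvd.mul_left (dvd_pow hQ (by omega)) _) _
  have h7 := (dvd_add_right h6).1 h5
  rw [one_mul, map_pow] at h7
  exact ht.isRadical _ _ h7

lemma exists_lift (t P : ℤ[X])
    (h : t.map (Int.castRingHom (ZMod 2)) ∣ P.map (Int.castRingHom (ZMod 2))) :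
    ∃ b e : ℤ[X], P = t * b + 2 * e := by
  obtain ⟨b', hb'⟩ := h
  obtain ⟨b, rfl⟩ := Polynomial.map_surjective (Int.castRingHom (ZMod 2))
    (ZMod.ringHom_surjective _) b'
  have h0 : (P - t * b).map (Int.castRingHom (ZMod 2)) = 0 := by
    rw [Polynomial.map_sub, Polynomial.map_mul, hb', sub_self]
  have h1 : C (2 : ℤ) ∣ P - t * b := by
    rw [C_dvd_iff_dvd_coeff]
    intro i
    have := congrArg (fun q => coeff q i) h0
    simp only [coeff_map, coeff_zero] at this
    exact (ZMod.intCast_zmod_eq_zero_iff_dvd _ 2).1 (by simpa using this)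
  obtain ⟨e, he⟩ := h1
  refine ⟨b, e, ?_⟩
  have : (C (2 : ℤ) : ℤ[X]) = 2 := _root_.map_ofNat C 2
  rw [this] at he
  linear_combination he

lemma two_poly : (2 : (ZMod 2)[X]) = 0 := by
  have : (C (2 : ZMod 2) : (ZMod 2)[X]) = 2 := _root_.map_ofNat C 2
  rw [← this, show (2 : ZMod 2) = 0 from rfl, C_0]

lemma zmod_two_cases : ∀ z : ZMod 2, z = 0 ∨ z = 1 := by decide

lemma squarefree_t : Squarefree (X ^ 3 + 1 : (ZMod 2)[X]) := by
  apply Separable.squarefree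
  refine ⟨1, X, ?_⟩
  have h3 : (C 2 : (ZMod 2)[X]) = 2 := _root_.map_ofNat C 2
  simp [h3]
  have h := two_poly
  linear_combination (2 * X ^ 3) * h

end Helpers

theorem stmt14 (c d : ℤ) (hc : (2 : ℤ) ∣ c) (hd : ¬ (2 : ℤ) ∣ d)
    (g : ℤ[X]) (hg : g = X ^ 6 + C c * X ^ 5 + C d)
    (hirr : Irreducible (g.map (Int.castRingHom ℚ)))
    (K : Type*) [Field K] [NumberField K] (θ : NumberField.RingOfIntegers K)
    (hroot : Polynomial.aeval θ g = 0)
    (hgen : Algebra.adjoin ℚ ({(θ : K)} : Set K) = ⊤) :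
    (¬ 2 ∣ indexZTheta θ ↔ c + d ≡ 1 [ZMOD 4]) ∧
      (c + d ≡ 1 [ZMOD 4] ↔
        ((c : ZMod 4), (d : ZMod 4)) ∈ ({(0, 1), (2, 3)} : Set (ZMod 4 × ZMod 4))) := by
  have hmonic : g.Monic := by rw [hg]; monicity!
  have hdeg : g.natDegree = 6 := by rw [hg]; compute_degree!
  have haK : ∀ P : ℤ[X], ((aeval θ P : 𝓞 K) : K) = aeval (θ : K) (P.map (Int.castRingHom ℚ)) := by
    intro P
    rw [← algebraMap_int_eq, aeval_map_algebraMap]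
    exact (aeval_algebraMap_apply K θ P).symm
  have hdvd : ∀ P : ℤ[X], aeval θ P = 0 → g ∣ P := by
    intro P hP
    have h1 : g.map (Int.castRingHom ℚ) = minpoly ℚ (θ : K) := by
      apply minpoly.eq_of_irreducible_of_monic hirr
      · rw [← haK, hroot]; rfl
      · exact hmonic.map _
    rw [← Polynomial.map_dvd_map (Int.castRingHom ℚ) Int.cast_injective hmonic, h1]
    apply minpoly.dvd
    rw [← haK, hP]; rfl
  have hmem : ∀ x : 𝓞 K, x ∈ (Algebra.adjoin ℤ ({θ} : Set (𝓞 K))).toSubring.toAddSubgroup ↔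
      ∃ P : ℤ[X], aeval θ P = x := by
    intro x
    change x ∈ Algebra.adjoin ℤ ({θ} : Set (𝓞 K)) ↔ _
    rw [Algebra.adjoin_singleton_eq_range_aeval]
    rfl
  unfold indexZTheta
  generalize (Algebra.adjoin ℤ ({θ} : Set (𝓞 K))).toSubring.toAddSubgroup = S at hmem
  obtain ⟨k, rfl⟩ := hc
  obtain ⟨m, rfl⟩ : ∃ m, d = 2 * m + 1 := ⟨d / 2, by omega⟩
  have hg0 : θ ^ 6 + 2 * (k : 𝓞 K) * θ ^ 5 + (2 * (m : 𝓞 K) + 1) = 0 := by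
    rw [hg] at hroot; simpa [_root_.map_ofNat] using hroot
  have hgmap : g.map (Int.castRingHom (ZMod 2)) = (X ^ 3 + 1) ^ 2 := by
    have h2 := two_poly
    have h2' : (2 : ZMod 2) = 0 := rfl
    rw [hg]; simp
    linear_combination (-X ^ 3 + k * X ^ 5 + m) * h2
  have htmap : (X ^ 3 + 1 : ℤ[X]).map (Int.castRingHom (ZMod 2)) = X ^ 3 + 1 := by simp
  refine ⟨⟨?_, ?_⟩, ?_⟩
  · -- if the congruence fails, exhibit an element of order two
    contrapose!
    intro hcong
    have hodd : ∃ r, k + m = 2 * r + 1 := by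
      refine ⟨(k + m) / 2, ?_⟩
      rw [Int.modEq_iff_dvd] at hcong
      omega
    obtain ⟨r, hr⟩ := hodd
    obtain rfl : m = 2 * r + 1 - k := by omega
    set e : ℤ := 1 + 2 * k with he
    let H : ℤ[X] := X ^ 5 + C e * (X ^ 4 + X ^ 3 + X ^ 2 + X + 1)
    let β : K := (aeval θ H : 𝓞 K) / 2
    have hgK : (θ : K) ^ 6 + 2 * (k : K) * θ ^ 5 + (2 * (2 * (r : K) + 1 - k) + 1) = 0 := by
      have := congrArg (algebraMap (𝓞 K) K) hg0
      simpa [_root_.map_ofNat] using this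
    have hβ : 2 * β = (θ : K) ^ 5 + (1 + 2 * k) * (θ ^ 4 + θ ^ 3 + θ ^ 2 + θ + 1) := by
      have : ((aeval θ H : 𝓞 K) : K) =
          (θ : K) ^ 5 + (1 + 2 * k) * (θ ^ 4 + θ ^ 3 + θ ^ 2 + θ + 1) := by
        simp [H, he, _root_.map_ofNat]
      rw [← this]
      simp only [β]
      field_simp
    have hint : IsIntegral ℤ β := by
      let q : 𝓞 K := θ ^ 4 + (2 + 2 * k) * θ ^ 3 + (3 + 4 * k) * θ ^ 2 + (4 + 6 * k) * θ + (5 + 8 * k)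
      have : IsIntegral (𝓞 K) β := by
        refine ⟨X ^ 2 - C (3 + 5 * (k : 𝓞 K)) * X + C (((r : 𝓞 K) + 1) * q), by monicity!, ?_⟩
        have h1 : β * (θ - 1) = - 2 * (r + 1) := by
          have : 2 * (β * ((θ : K) - 1)) = 2 * (-2 * (r + 1)) := by
            linear_combination (θ - 1) * hβ + hgK
          exact mul_left_cancel₀ two_ne_zero this
        have hq : algebraMap (𝓞 K) K q = (θ : K) ^ 4 + (2 + 2 * k) * θ ^ 3 + (3 + 4 * k) * θ ^ 2
            + (4 + 6 * k) * θ + (5 + 8 * k) := by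
          simp [q, _root_.map_ofNat]
        simp only [eval₂_add, eval₂_sub, eval₂_mul, eval₂_pow, eval₂_X, eval₂_C]
        simp only [_root_.map_mul, hq, _root_.map_add, map_intCast, _root_.map_ofNat, _root_.map_one]
        have : 2 * (β ^ 2 - (3 + 5 * (k : K)) * β + ((r : K) + 1) * ((θ : K) ^ 4 +
            (2 + 2 * k) * θ ^ 3 + (3 + 4 * k) * θ ^ 2 + (4 + 6 * k) * θ + (5 + 8 * k))) = 2 * 0 := by
          linear_combination β * hβ + ((θ : K) ^ 4 +
            (2 + 2 * k) * θ ^ 3 + (3 + 4 * k) * θ ^ 2 + (4 + 6 * k) * θ + (5 + 8 * k)) * h1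
        exact mul_left_cancel₀ two_ne_zero this
      exact isIntegral_trans (R := ℤ) (A := 𝓞 K) β this
    let b : 𝓞 K := ⟨β, hint⟩
    have hb : 2 * b = aeval θ H := by
      apply NumberField.RingOfIntegers.ext
      change 2 * β = _
      simp only [β]
      field_simp
    have hbS : b ∉ S := by
      rw [hmem]
      rintro ⟨P, hP⟩
      have h1 : g ∣ 2 * P - H := by
        apply hdvd
        rw [_root_.map_sub, _root_.map_mul, hP, ← hb]
        simp [_root_.map_ofNat]
      have h2 := map_dvd (mapRingHom (Int.castRingHom (ZMod 2))) h1
      simp only [_root_.map_sub, _root_.map_mul, _root_.map_ofNat, two_poly, zero_mul, zero_sub, dvd_neg] at h2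
      have hHm : H.Monic := by simp only [H]; monicity!
      have hHd : H.natDegree = 5 := by simp only [H]; compute_degree!
      have := natDegree_le_of_dvd h2 (hHm.map _).ne_zero
      simp only [coe_mapRingHom, hHm.natDegree_map, hmonic.natDegree_map] at this
      omega
    have ho : addOrderOf (QuotientAddGroup.mk b : 𝓞 K ⧸ S) = 2 := by
      apply addOrderOf_eq_prime
      · rw [← QuotientAddGroup.mk_nsmul, QuotientAddGroup.eq_zero_iff, hmem]
        exact ⟨H, by rw [← hb]; simp⟩
      · rwa [Ne, QuotientAddGroup.eq_zero_iff]
    rw [← ho]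
    exact addOrderOf_dvd_natCard _
  · intro hcong hdiv
    have heven : ∃ r, k + m = 2 * r := by
      refine ⟨(k + m) / 2, ?_⟩
      rw [Int.modEq_iff_dvd] at hcong
      omega
    obtain ⟨r, hr⟩ := heven
    -- the quotient is finite
    have hfin : Finite (𝓞 K ⧸ S) := by
      have : Module.Finite ℤ (𝓞 K ⧸ S) :=
        Module.Finite.of_surjective (QuotientAddGroup.mk' S).toIntLinearMap
          (QuotientAddGroup.mk'_surjective S)
      apply Module.finite_of_fg_torsion
      intro y
      obtain ⟨x, rfl⟩ := QuotientAddGroup.mk_surjective y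
      have hx : (x : K) ∈ Algebra.adjoin ℚ ({(θ : K)} : Set K) := by rw [hgen]; trivial
      rw [Algebra.adjoin_singleton_eq_range_aeval] at hx
      obtain ⟨p, hp⟩ := hx
      obtain ⟨n, hn0, hn⟩ := IsLocalization.integerNormalization_spec (nonZeroDivisors ℤ) p
      refine ⟨⟨n, hn0⟩, ?_⟩
      change n • (QuotientAddGroup.mk x : 𝓞 K ⧸ S) = 0
      rw [← QuotientAddGroup.mk_zsmul, QuotientAddGroup.eq_zero_iff, hmem]
      refine ⟨IsLocalization.integerNormalization (nonZeroDivisors ℤ) p, ?_⟩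
      apply NumberField.RingOfIntegers.ext
      rw [haK, ← algebraMap_int_eq, hn, map_zsmul]
      change n • _ = algebraMap (𝓞 K) K (n • x)
      rw [map_zsmul]
      congr 1
    have : Fact (Nat.Prime 2) := ⟨Nat.prime_two⟩
    obtain ⟨x, hx⟩ := exists_prime_addOrderOf_dvd_card' 2 hdiv
    obtain ⟨α, rfl⟩ := QuotientAddGroup.mk_surjective x
    have hα2 : 2 • α ∈ S := by
      rw [← QuotientAddGroup.eq_zero_iff, QuotientAddGroup.mk_nsmul, ← hx]
      exact addOrderOf_nsmul_eq_zero _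
    have hα : α ∉ S := by
      rw [← QuotientAddGroup.eq_zero_iff, ← AddMonoid.addOrderOf_eq_one_iff, hx]
      norm_num
    apply hα
    obtain ⟨a, ha⟩ := (hmem _).1 hα2
    rw [nsmul_eq_mul, Nat.cast_ofNat] at ha
    have key := dvd_of_eq_mul_integral θ g hdvd (X ^ 3 + 1) squarefree_t
      (by rw [hgmap]; exact dvd_pow_self _ two_ne_zero)
    have hI : ∀ x : 𝓞 K, IsIntegral ℤ x := fun x => Algebra.IsIntegral.isIntegral x
    have h1 := key a 2 α (hI _) (by rw [ha]; simp [_root_.map_ofNat]) (by simp [two_poly])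
    rw [← htmap] at h1
    obtain ⟨b, e, rfl⟩ := exists_lift _ _ h1
    let F : ℤ[X] := C k * X ^ 5 - X ^ 3 + C m
    have hF : (θ ^ 3 + 1) ^ 2 = - 2 * aeval θ F := by
      simp [F]
      linear_combination hg0
    have ha' : (θ ^ 3 + 1) * aeval θ b + 2 * aeval θ e = 2 * α := by
      rw [← ha]; simp [_root_.map_ofNat]
    have h2 := key (F * b) (X ^ 3 + 1) (-(α - aeval θ e)) (hI _) (by
      have : (2 : 𝓞 K) ≠ 0 := two_ne_zero
      apply mul_left_cancel₀ this
      simp only [map_mul, map_add, map_pow, aeval_X, map_one]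
      linear_combination (aeval θ b) * hF - (θ ^ 3 + 1) * ha') (by rw [htmap])
    have hcop : IsCoprime (X ^ 3 + 1 : (ZMod 2)[X]) (F.map (Int.castRingHom (ZMod 2))) := by
      have h2 := two_poly
      have hkm : (m : ZMod 2) = k := by
        have : (k : ZMod 2) + m = 0 := by
          have := congrArg (Int.cast : ℤ → ZMod 2) hr
          push_cast at this
          rw [this, show (2 : ZMod 2) = 0 from rfl, zero_mul]
        have h2' : (2 : ZMod 2) = 0 := rfl
        linear_combination this - k * h2'
      have hk : (k : ZMod 2) = 0 ∨ (k : ZMod 2) = 1 := by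
        exact zmod_two_cases _
      have hFm : F.map (Int.castRingHom (ZMod 2)) =
          C (k : ZMod 2) * X ^ 5 - X ^ 3 + C (k : ZMod 2) := by
        rw [← hkm]
        simp only [F, Polynomial.map_add, Polynomial.map_sub, Polynomial.map_mul, map_C,
          Polynomial.map_pow, map_X]
        simp only [eq_intCast, hkm]
      rw [hFm]
      rcases hk with hk | hk
      · refine ⟨1, 1, ?_⟩
        rw [hk]; simp
      · refine ⟨X ^ 3 + 1 + X, X, ?_⟩
        rw [hk]; simp
        linear_combination (X ^ 6 + X ^ 3 + X) * h2
    rw [Polynomial.map_mul] at h2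
    have h3 := hcop.dvd_of_dvd_mul_left h2
    rw [← htmap] at h3
    obtain ⟨b', e', rfl⟩ := exists_lift _ _ h3
    rw [hmem]
    refine ⟨-F * b' + (X ^ 3 + 1) * e' + e, ?_⟩
    apply mul_left_cancel₀ (two_ne_zero : (2 : 𝓞 K) ≠ 0)
    rw [← ha']
    simp only [map_mul, map_add, map_pow, aeval_X, map_one, map_neg, _root_.map_ofNat]
    linear_combination (-aeval θ b') * hF
  · rw [Int.modEq_iff_dvd]
    have e1 : ∀ a b : ℤ, (a : ZMod 4) = b ↔ (4 : ℤ) ∣ b - a := fun a b => by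
      rw [ZMod.intCast_eq_intCast_iff_dvd_sub]; rfl
    have a1 := e1 (2 * k) 0
    have a2 := e1 (2 * k) 2
    have a3 := e1 (2 * m + 1) 1
    have a4 := e1 (2 * m + 1) 3
    rw [Int.cast_zero] at a1
    rw [Int.cast_ofNat] at a2 a4
    rw [Int.cast_one] at a3
    simp only [Set.mem_insert_iff, Set.mem_singleton_iff, Prod.mk.injEq, a1, a2, a3, a4]
    omega
end
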